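/- arXiv:1706.01873 — 2 statements merged into one kernel-verified Lean document; each statement's English description precedes it below -/
import Mathlib

section
/- If Ω ⊂ X is a nonempty bounded open set with diam Ω < (1/4) diam X and the class K_{ψ,f}(Ω) is nonempty, then there exists a solution of the K_{ψ,f}(Ω)-obstacle problem. -/
open MeasureTheory Metric Filter Set
open scoped ENNReal NNReal Topology

noncomputable section

namespace MetricBV

variable {X : Type*} [MetricSpace X] [MeasurableSpace X]

/-- A rectifiable curve, encoded as a Lipschitz map on the interval `[0,1]`
(every rectifiable curve admits such a reparametrization). -/
structure Curve (X : Type*) [MetricSpace X] where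
  toFun : ℝ → X
  lipschitz : ∃ K : ℝ≥0, LipschitzOnWith K toFun (Set.Icc 0 1)

/-- The metric speed of a curve at a point. -/
def speed (γ : ℝ → X) (t : ℝ) : ℝ≥0∞ :=
  Filter.limsup (fun h : ℝ => ENNReal.ofReal (dist (γ (t + h)) (γ t) / |h|)) (𝓝[≠] (0 : ℝ))

/-- The curve integral `∫_γ g ds`. -/
def curveIntegral (g : X → ℝ≥0∞) (γ : Curve X) : ℝ≥0∞ :=
  ∫⁻ t in Set.Icc (0 : ℝ) 1, g (γ.toFun t) * speed γ.toFun t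

/-- A curve lies in a set `Ω`. -/
def Curve.In (γ : Curve X) (Ω : Set X) : Prop :=
  ∀ t ∈ Set.Icc (0 : ℝ) 1, γ.toFun t ∈ Ω

/-- The 1-modulus of a family of curves. -/
def Mod1 (μ : Measure X) (Γ : Set (Curve X)) : ℝ≥0∞ :=
  ⨅ (ρ : X → ℝ≥0∞) (_ : Measurable ρ) (_ : ∀ γ ∈ Γ, 1 ≤ curveIntegral ρ γ),
    ∫⁻ x, ρ x ∂μ

/-- `g` is an upper gradient of `u` in `Ω`: the upper gradient inequality holds
along every curve contained in `Ω`. -/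
def IsUpperGradientOn (g : X → ℝ≥0∞) (u : X → ℝ) (Ω : Set X) : Prop :=
  ∀ γ : Curve X, γ.In Ω →
    ENNReal.ofReal |u (γ.toFun 1) - u (γ.toFun 0)| ≤ curveIntegral g γ

/-- `g` is a 1-weak upper gradient of `u` in `Ω`: the upper gradient inequality holds
along every curve in `Ω` outside a family of zero 1-modulus. -/
def IsWeakUpperGradientOn (μ : Measure X) (g : X → ℝ≥0∞) (u : X → ℝ) (Ω : Set X) : Prop :=
  ∃ Γ : Set (Curve X), Mod1 μ Γ = 0 ∧
    ∀ γ : Curve X, γ ∉ Γ → γ.In Ω →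
      ENNReal.ofReal |u (γ.toFun 1) - u (γ.toFun 0)| ≤ curveIntegral g γ

/-- Membership in the Newtonian space `N^{1,1}(X)`. -/
def MemN11 (μ : Measure X) (u : X → ℝ) : Prop :=
  Integrable u μ ∧ ∃ g : X → ℝ≥0∞, Measurable g ∧
    IsWeakUpperGradientOn μ g u Set.univ ∧ ∫⁻ x, g x ∂μ < ⊤

/-- The 1-capacity `cap₁(A) = inf ‖u‖_{N^{1,1}(X)}` over `u ∈ N^{1,1}(X)` with `u ≥ 1` on `A`. -/
def cap1 (μ : Measure X) (A : Set X) : ℝ≥0∞ :=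
  ⨅ (u : X → ℝ) (_ : MemN11 μ u) (_ : ∀ x ∈ A, 1 ≤ u x)
    (g : X → ℝ≥0∞) (_ : Measurable g) (_ : IsWeakUpperGradientOn μ g u Set.univ),
    (∫⁻ x, ENNReal.ofReal |u x| ∂μ + ∫⁻ x, g x ∂μ)

/-- The variational 1-capacity `cap₁(A,Ω) = inf ∫ g_u dμ` over `u ∈ N^{1,1}(X)` with
`u ≥ 1` on `A` and `u = 0` on `X ∖ Ω`. -/
def vcap1 (μ : Measure X) (A Ω : Set X) : ℝ≥0∞ :=
  ⨅ (u : X → ℝ) (_ : MemN11 μ u) (_ : ∀ x ∈ A, 1 ≤ u x) (_ : ∀ x ∈ Ωᶜ, u x = 0)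
    (g : X → ℝ≥0∞) (_ : Measurable g) (_ : IsWeakUpperGradientOn μ g u Set.univ),
    ∫⁻ x, g x ∂μ

/-- Locally Lipschitz in `Ω`: Lipschitz on every compact subset of `Ω`. -/
def LocLipschitzOn (u : X → ℝ) (Ω : Set X) : Prop :=
  ∀ K : Set X, IsCompact K → K ⊆ Ω → ∃ L : ℝ≥0, LipschitzOnWith L u K

/-- Convergence `v i → u` in `L¹_loc(Ω)`. -/
def TendstoL1Loc (μ : Measure X) (v : ℕ → X → ℝ) (u : X → ℝ) (Ω : Set X) : Prop :=
  ∀ K : Set X, IsCompact K → K ⊆ Ω →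
    Filter.Tendsto (fun i => ∫⁻ x in K, ENNReal.ofReal |v i x - u x| ∂μ)
      Filter.atTop (𝓝 0)

/-- The total variation `‖Du‖(Ω)` of `u` in an open set `Ω`: the infimum of
`liminf ∫_Ω g_i dμ` over sequences of locally Lipschitz functions `v i → u` in `L¹_loc(Ω)`
with `g i` a 1-weak upper gradient of `v i` in `Ω`. -/
def tv (μ : Measure X) (u : X → ℝ) (Ω : Set X) : ℝ≥0∞ :=
  ⨅ (v : ℕ → X → ℝ) (_ : ∀ i, LocLipschitzOn (v i) Ω) (_ : TendstoL1Loc μ v u Ω)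
    (g : ℕ → X → ℝ≥0∞) (_ : ∀ i, Measurable (g i))
    (_ : ∀ i, IsWeakUpperGradientOn μ (g i) (v i) Ω),
    Filter.liminf (fun i => ∫⁻ x in Ω, g i x ∂μ) Filter.atTop

/-- The total variation `‖Du‖(A)` for an arbitrary set `A`. -/
def tvs (μ : Measure X) (u : X → ℝ) (A : Set X) : ℝ≥0∞ :=
  ⨅ (U : Set X) (_ : IsOpen U) (_ : A ⊆ U), tv μ u U

/-- The characteristic function of a set, as a real-valued function. -/
def chi (E : Set X) : X → ℝ := Set.indicator E fun _ => (1 : ℝ)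

/-- The perimeter `P(E,Ω) = ‖Dχ_E‖(Ω)` of `E` in an open set `Ω`. -/
def perim (μ : Measure X) (E : Set X) (Ω : Set X) : ℝ≥0∞ := tv μ (chi E) Ω

/-- `u ∈ BV(Ω)`: `u ∈ L¹(Ω)` and `‖Du‖(Ω) < ∞`. -/
def MemBV (μ : Measure X) (u : X → ℝ) (Ω : Set X) : Prop :=
  IntegrableOn u Ω μ ∧ tv μ u Ω < ⊤

/-- `u ∈ BV_loc(Ω)`. -/
def MemBVloc (μ : Measure X) (u : X → ℝ) (Ω : Set X) : Prop :=
  ∀ K : Set X, IsCompact K → K ⊆ Ω → ∃ U : Set X, IsOpen U ∧ K ⊆ U ∧ U ⊆ Ω ∧ MemBV μ u U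

/-- `φ ∈ BV_c(Ω)`: a BV function with compact support in `Ω`. -/
def MemBVc (μ : Measure X) (φ : X → ℝ) (Ω : Set X) : Prop :=
  MemBV μ φ Ω ∧ IsCompact (tsupport φ) ∧ tsupport φ ⊆ Ω

/-- `u` is a 1-minimizer (function of least gradient) in `Ω`. -/
def IsMinimizer (μ : Measure X) (u : X → ℝ) (Ω : Set X) : Prop :=
  MemBVloc μ u Ω ∧ ∀ φ : X → ℝ, MemBVc μ φ Ω →
    tvs μ u (tsupport φ) ≤ tvs μ (fun y => u y + φ y) (tsupport φ)

/-- `u` is a 1-superminimizer in `Ω`. -/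
def IsSuperminimizer (μ : Measure X) (u : X → ℝ) (Ω : Set X) : Prop :=
  MemBVloc μ u Ω ∧ ∀ φ : X → ℝ, MemBVc μ φ Ω → (∀ x, 0 ≤ φ x) →
    tvs μ u (tsupport φ) ≤ tvs μ (fun y => u y + φ y) (tsupport φ)

/-- `u` is a 1-subminimizer in `Ω`. -/
def IsSubminimizer (μ : Measure X) (u : X → ℝ) (Ω : Set X) : Prop :=
  MemBVloc μ u Ω ∧ ∀ φ : X → ℝ, MemBVc μ φ Ω → (∀ x, φ x ≤ 0) →
    tvs μ u (tsupport φ) ≤ tvs μ (fun y => u y + φ y) (tsupport φ)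

/-- The lower approximate limit `u^∧(x)`, with values in `[-∞,∞]`. -/
def lowerApprox (μ : Measure X) (u : X → ℝ) (x : X) : EReal :=
  sSup ((fun t : ℝ => (t : EReal)) '' {t : ℝ | Filter.Tendsto
    (fun r : ℝ => μ ({y | u y < t} ∩ Metric.ball x r) / μ (Metric.ball x r))
    (𝓝[>] (0 : ℝ)) (𝓝 0)})

/-- The upper approximate limit `u^∨(x)`, with values in `[-∞,∞]`. -/
def upperApprox (μ : Measure X) (u : X → ℝ) (x : X) : EReal :=
  sInf ((fun t : ℝ => (t : EReal)) '' {t : ℝ | Filter.Tendsto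
    (fun r : ℝ => μ ({y | t < u y} ∩ Metric.ball x r) / μ (Metric.ball x r))
    (𝓝[>] (0 : ℝ)) (𝓝 0)})

/-- The upper approximate limit of an extended-real-valued function. -/
def upperApproxE (μ : Measure X) (ψ : X → EReal) (x : X) : EReal :=
  sInf ((fun t : ℝ => (t : EReal)) '' {t : ℝ | Filter.Tendsto
    (fun r : ℝ => μ ({y | (t : EReal) < ψ y} ∩ Metric.ball x r) / μ (Metric.ball x r))
    (𝓝[>] (0 : ℝ)) (𝓝 0)})

/-- The measure-theoretic interior `I_E`. -/
def measInterior (μ : Measure X) (E : Set X) : Set X :=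
  {x : X | Filter.Tendsto (fun r : ℝ => μ (Metric.ball x r \ E) / μ (Metric.ball x r))
    (𝓝[>] (0 : ℝ)) (𝓝 0)}

/-- The measure-theoretic boundary `∂*E`. -/
def measBoundary (μ : Measure X) (E : Set X) : Set X :=
  {x : X | 0 < Filter.limsup (fun r : ℝ => μ (Metric.ball x r ∩ E) / μ (Metric.ball x r))
      (𝓝[>] (0 : ℝ)) ∧
    0 < Filter.limsup (fun r : ℝ => μ (Metric.ball x r \ E) / μ (Metric.ball x r))
      (𝓝[>] (0 : ℝ))}

/-- `A` is 1-thin at `x`. -/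
def IsThinAt (μ : Measure X) (A : Set X) (x : X) : Prop :=
  Filter.Tendsto (fun r : ℝ =>
      ENNReal.ofReal r * vcap1 μ (A ∩ Metric.ball x r) (Metric.ball x (2 * r))
        / μ (Metric.ball x r))
    (𝓝[>] (0 : ℝ)) (𝓝 0)

/-- `U` is 1-finely open. -/
def IsFinelyOpen (μ : Measure X) (U : Set X) : Prop :=
  ∀ x ∈ U, IsThinAt μ Uᶜ x

/-- The class `K_{ψ,f}(Ω)` of admissible functions for the obstacle problem. -/
def MemK (μ : Measure X) (ψ : X → EReal) (f : X → ℝ) (Ω : Set X) (u : X → ℝ) : Prop :=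
  MemBVloc μ u Set.univ ∧ (∀ᵐ x ∂μ, x ∈ Ω → ψ x ≤ (u x : EReal)) ∧
    (∀ᵐ x ∂μ, x ∉ Ω → u x = f x)

/-- `u` is a solution of the `K_{ψ,f}(Ω)`-obstacle problem. -/
def IsObstacleSolution (μ : Measure X) (ψ : X → EReal) (f : X → ℝ) (Ω : Set X)
    (u : X → ℝ) : Prop :=
  MemK μ ψ f Ω u ∧ ∀ v : X → ℝ, MemK μ ψ f Ω v → tv μ u Set.univ ≤ tv μ v Set.univ

/-- The standing assumptions: `(X,d,μ)` is a complete metric space with at least two points,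
`μ` is a doubling measure with constant `Cd`, and `X` supports a `(1,1)`-Poincaré inequality
with constants `CP`, `lam`. -/
structure MMS {X : Type*} [MetricSpace X] [MeasurableSpace X] (μ : Measure X)
    (Cd CP lam : ℝ) : Prop where
  complete : CompleteSpace X
  nontrivial : Nontrivial X
  hCd : 1 ≤ Cd
  hCP : 0 < CP
  hlam : 1 ≤ lam
  doubling : ∀ (x : X) (r : ℝ), 0 < r →
    0 < μ (Metric.ball x (2 * r)) ∧
    μ (Metric.ball x (2 * r)) ≤ ENNReal.ofReal Cd * μ (Metric.ball x r) ∧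
    μ (Metric.ball x r) < ⊤
  poincare : ∀ (x : X) (r : ℝ), 0 < r → ∀ u : X → ℝ, MeasureTheory.LocallyIntegrable u μ →
    ∀ g : X → ℝ≥0∞, Measurable g → IsUpperGradientOn g u Set.univ →
      ∫⁻ y in Metric.ball x r, ENNReal.ofReal |u y - ⨍ z in Metric.ball x r, u z ∂μ| ∂μ ≤
        ENNReal.ofReal (CP * r) * (μ (Metric.ball x r) / μ (Metric.ball x (lam * r))) *
          ∫⁻ y in Metric.ball x (lam * r), g y ∂μ


omit [MeasurableSpace X] in
lemma exists_maximal_separated (s : Set X) {δ : ℝ} (hδ : 0 < δ) :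
    ∃ N ⊆ s, N.Pairwise (fun x y => δ ≤ dist x y) ∧ ∀ z ∈ s, ∃ x ∈ N, dist z x < δ := by
  obtain ⟨N, hN⟩ := zorn_subset
    {N : Set X | N ⊆ s ∧ N.Pairwise (fun x y => δ ≤ dist x y)} (by
      intro c hc hchain
      refine ⟨⋃₀ c, ⟨sUnion_subset fun t ht => (hc ht).1, ?_⟩, fun t ht => subset_sUnion_of_mem ht⟩
      exact (pairwise_sUnion hchain.directedOn).2 fun t ht => (hc ht).2)
  refine ⟨N, hN.prop.1, hN.prop.2, fun z hz => ?_⟩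
  by_contra! h
  have hmem : insert z N ∈ {N : Set X | N ⊆ s ∧ N.Pairwise (fun x y => δ ≤ dist x y)} := by
    refine ⟨insert_subset hz hN.prop.1, hN.prop.2.insert fun x hx _ => ⟨h x hx, ?_⟩⟩
    rw [dist_comm]
    exact h x hx
  have hzN : z ∈ N := hN.le_of_ge hmem (subset_insert z N) (mem_insert z N)
  have := h z hzN
  rw [dist_self] at this
  linarith

namespace MMS

variable {μ : Measure X} {Cd CP lam : ℝ}

lemma measure_ball_pos (hX : MMS μ Cd CP lam) (x : X) {r : ℝ} (hr : 0 < r) :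
    0 < μ (ball x r) := by
  have := (hX.doubling x (r / 2) (by positivity)).1
  rwa [mul_div_cancel₀ r two_ne_zero] at this

lemma measure_ball_lt_top (hX : MMS μ Cd CP lam) (x : X) (r : ℝ) : μ (ball x r) < ⊤ := by
  rcases le_or_gt r 0 with hr | hr
  · simp [ball_eq_empty.2 hr]
  · exact (hX.doubling x r hr).2.2

lemma measure_ball_two_pow_mul_le (hX : MMS μ Cd CP lam) (x : X) {r : ℝ} (hr : 0 < r) (k : ℕ) :
    μ (ball x (2 ^ k * r)) ≤ ENNReal.ofReal Cd ^ k * μ (ball x r) := by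
  induction k with
  | zero => simp
  | succ k ih =>
    calc μ (ball x (2 ^ (k + 1) * r)) = μ (ball x (2 * (2 ^ k * r))) := by ring_nf
      _ ≤ ENNReal.ofReal Cd * μ (ball x (2 ^ k * r)) :=
        (hX.doubling x (2 ^ k * r) (by positivity)).2.1
      _ ≤ ENNReal.ofReal Cd * (ENNReal.ofReal Cd ^ k * μ (ball x r)) := by gcongr
      _ = ENNReal.ofReal Cd ^ (k + 1) * μ (ball x r) := by ring

/-- Balls of radius `R` are controlled by balls of radius `r` centred at one of their points, with
a constant depending only on an upper bound for the ratio `R / r`. -/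
lemma exists_measure_ball_le (hX : MMS μ Cd CP lam) (a : ℝ) :
    ∃ D : ℝ≥0∞, D ≠ ⊤ ∧ ∀ (x z : X) (r : ℝ), 0 < r → dist x z ≤ a * r →
      μ (ball z (a * r)) ≤ D * μ (ball x r) := by
  obtain ⟨k, hk⟩ := pow_unbounded_of_one_lt (2 * a) one_lt_two
  refine ⟨ENNReal.ofReal Cd ^ k, ENNReal.pow_ne_top ENNReal.ofReal_ne_top, fun x z r hr hxz => ?_⟩
  refine (measure_mono (ball_subset_ball' ?_)).trans (hX.measure_ball_two_pow_mul_le x hr k)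
  rw [dist_comm]
  nlinarith

omit [MeasurableSpace X] in
lemma pairwise_disjoint_ball {N : Set X} {δ : ℝ} (hN : N.Pairwise (fun x y => δ ≤ dist x y)) :
    N.PairwiseDisjoint (fun x => ball x (δ / 2)) := by
  intro x hx y hy hxy
  exact ball_disjoint_ball (by have := hN hx hy hxy; linarith)

variable [BorelSpace X]

/-- A `δ`-separated subset of a bounded set is finite. -/
lemma finite_of_separated (hX : MMS μ Cd CP lam) {x₀ : X} {R δ : ℝ} (hR : 0 < R) (hδ : 0 < δ)
    {N : Set X} (hNs : N ⊆ closedBall x₀ R) (hN : N.Pairwise (fun x y => δ ≤ dist x y)) :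
    N.Finite := by
  obtain ⟨D, hD, hball⟩ := hX.exists_measure_ball_le ((R + δ) / (δ / 2))
  have hR' : (R + δ) / (δ / 2) * (δ / 2) = R + δ := by field_simp
  have hlow : ∀ x : N, μ (ball x₀ (R + δ)) / D ≤ μ (ball (x : X) (δ / 2)) := by
    intro x
    refine ENNReal.div_le_of_le_mul' ?_
    have := hball x x₀ (δ / 2) (by positivity)
    rw [hR'] at this
    exact this ((mem_closedBall.1 (hNs x.2)).trans (by linarith))
  have hfin := Measure.finite_const_le_meas_of_disjoint_iUnion μ
    (ENNReal.div_pos (hX.measure_ball_pos x₀ (add_pos hR hδ)).ne' hD)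
    (As := fun x : N => ball (x : X) (δ / 2)) (fun _ => measurableSet_ball)
    (fun x y hxy => pairwise_disjoint_ball hN x.2 y.2 (Subtype.coe_injective.ne hxy)) (by
      refine ((measure_mono (iUnion_subset fun x => ?_)).trans_lt
        (hX.measure_ball_lt_top x₀ (R + δ))).ne
      refine ball_subset_ball' ?_
      have := mem_closedBall.1 (hNs x.2)
      linarith)
  exact Set.finite_coe_iff.1 (Set.finite_univ_iff.1 (hfin.subset fun x _ => hlow x))

lemma exists_finite_net (hX : MMS μ Cd CP lam) (x₀ : X) {R δ : ℝ} (hR : 0 < R) (hδ : 0 < δ) :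
    ∃ J : Finset X, (J : Set X) ⊆ closedBall x₀ R ∧
      (J : Set X).Pairwise (fun x y => δ ≤ dist x y) ∧
      closedBall x₀ R ⊆ ⋃ x ∈ J, ball x δ := by
  obtain ⟨N, hNs, hN, hcov⟩ := exists_maximal_separated (closedBall x₀ R) hδ
  lift N to Finset X using hX.finite_of_separated hR hδ hNs hN
  refine ⟨N, hNs, hN, fun z hz => ?_⟩
  obtain ⟨x, hx, hzx⟩ := hcov z hz
  exact mem_iUnion₂.2 ⟨x, hx, hzx⟩

lemma properSpace (hX : MMS μ Cd CP lam) : ProperSpace X := by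
  have := hX.complete
  refine ProperSpace.of_isCompact_closedBall_of_le 1 fun x r hr => ?_
  refine isCompact_iff_totallyBounded_isComplete.2
    ⟨Metric.totallyBounded_iff.2 fun ε hε => ?_, isClosed_closedBall.isComplete⟩
  obtain ⟨J, -, -, hJ⟩ := hX.exists_finite_net x (by linarith : 0 < r) hε
  exact ⟨J, J.finite_toSet, hJ⟩

omit [BorelSpace X] in
lemma isLocallyFiniteMeasure (hX : MMS μ Cd CP lam) : IsLocallyFiniteMeasure μ :=
  ⟨fun x => ⟨ball x 1, ball_mem_nhds x one_pos, hX.measure_ball_lt_top x 1⟩⟩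

/-- Enlarged balls centred at a separated set have bounded overlap, uniformly in the scale. -/
lemma exists_overlap_bound (hX : MMS μ Cd CP lam) (a : ℝ) :
    ∃ D : ℝ≥0∞, D ≠ ⊤ ∧ ∀ (J : Finset X) (δ : ℝ), 0 < δ →
      (J : Set X).Pairwise (fun x y => δ ≤ dist x y) → ∀ g : X → ℝ≥0∞, Measurable g →
        ∑ x ∈ J, ∫⁻ y in ball x (a * δ), g y ∂μ ≤ D * ∫⁻ y, g y ∂μ := by
  classical
  obtain ⟨D, hD, hball⟩ := hX.exists_measure_ball_le (2 * (|a| + 1))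
  refine ⟨D, hD, fun J δ hδ hJ g hg => ?_⟩
  have hcount : ∀ z : X, ((J.filter fun x => z ∈ ball x (a * δ)).card : ℝ≥0∞) ≤ D := by
    intro z
    set Jz := J.filter fun x => z ∈ ball x (a * δ)
    have hz : ∀ x ∈ Jz, dist x z ≤ |a| * δ := by
      intro x hx
      have h1 := mem_ball'.1 (Finset.mem_filter.1 hx).2
      have h2 := mul_le_mul_of_nonneg_right (le_abs_self a) hδ.le
      linarith
    have hrad : 2 * (|a| + 1) * (δ / 2) = (|a| + 1) * δ := by ring
    have hpos : 0 < (|a| + 1) * δ := by positivity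
    set m := μ (ball z ((|a| + 1) * δ))
    have hm0 : m ≠ 0 := (hX.measure_ball_pos z hpos).ne'
    have hmt : m ≠ ⊤ := (hX.measure_ball_lt_top z _).ne
    have hsum : (Jz.card : ℝ≥0∞) * m ≤ D * m := by
      calc (Jz.card : ℝ≥0∞) * m = ∑ x ∈ Jz, m := by simp
        _ ≤ ∑ x ∈ Jz, D * μ (ball x (δ / 2)) := by
          refine Finset.sum_le_sum fun x hx => ?_
          have := hball x z (δ / 2) (by positivity)
          rw [hrad] at this
          exact this ((hz x hx).trans (by nlinarith))
        _ = D * μ (⋃ x ∈ Jz, ball x (δ / 2)) := by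
          rw [← Finset.mul_sum, measure_biUnion_finset _ fun _ _ => measurableSet_ball]
          exact (pairwise_disjoint_ball hJ).subset
            (Finset.coe_subset.2 (Finset.filter_subset _ _))
        _ ≤ D * m := by
          gcongr
          refine measure_mono (iUnion₂_subset fun x hx => ball_subset_ball' ?_)
          have := hz x hx
          linarith
    exact (ENNReal.mul_le_mul_iff_left hm0 hmt).1 hsum
  calc ∑ x ∈ J, ∫⁻ y in ball x (a * δ), g y ∂μ
      = ∫⁻ y, ∑ x ∈ J, (ball x (a * δ)).indicator g y ∂μ := by
        rw [lintegral_finsetSum _ fun x _ => hg.indicator measurableSet_ball]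
        simp_rw [lintegral_indicator measurableSet_ball]
    _ ≤ ∫⁻ y, D * g y ∂μ := by
        refine lintegral_mono fun y => ?_
        calc ∑ x ∈ J, (ball x (a * δ)).indicator g y
            = (J.filter fun x => y ∈ ball x (a * δ)).card * g y := by
              simp [indicator_apply, Finset.sum_ite]
          _ ≤ D * g y := by gcongr; exact hcount y
    _ = D * ∫⁻ y, g y ∂μ := lintegral_const_mul _ hg

end MMS

lemma Mod1_empty (μ : Measure X) : Mod1 μ ∅ = 0 := by
  refine le_antisymm ?_ zero_le
  exact iInf_le_of_le (fun _ => 0) (iInf_le_of_le measurable_const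
    (iInf_le_of_le (by simp) (by simp)))

lemma IsUpperGradientOn.isWeakUpperGradientOn {μ : Measure X} {g : X → ℝ≥0∞} {u : X → ℝ}
    {Ω : Set X} (h : IsUpperGradientOn g u Ω) : IsWeakUpperGradientOn μ g u Ω :=
  ⟨∅, Mod1_empty μ, fun γ _ => h γ⟩

omit [MeasurableSpace X] in
lemma curveIntegral_mono {g h : X → ℝ≥0∞} (hgh : g ≤ h) (γ : Curve X) :
    curveIntegral g γ ≤ curveIntegral h γ :=
  lintegral_mono fun t => mul_le_mul_left (hgh (γ.toFun t)) _

omit [MeasurableSpace X] in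
lemma sum_curveIntegral_le (ρ : ℕ → X → ℝ≥0∞) (γ : Curve X) (n : ℕ) :
    ∑ k ∈ Finset.range n, curveIntegral (ρ k) γ ≤
      curveIntegral (fun x => ∑ k ∈ Finset.range n, ρ k x) γ := by
  induction n with
  | zero => simp
  | succ n ih =>
    rw [Finset.sum_range_succ]
    refine (add_le_add_left ih _).trans ((le_lintegral_add _ _).trans_eq ?_)
    simp only [curveIntegral, Finset.sum_range_succ, add_mul]

/-- A 1-weak upper gradient can be turned into an upper gradient by an arbitrarily small change of
its integral. -/
lemma IsWeakUpperGradientOn.exists_isUpperGradientOn {μ : Measure X} {g : X → ℝ≥0∞} {u : X → ℝ}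
    {Ω : Set X} (h : IsWeakUpperGradientOn μ g u Ω) (hg : Measurable g) {ε : ℝ≥0∞} (hε : ε ≠ 0) :
    ∃ g' : X → ℝ≥0∞, Measurable g' ∧ IsUpperGradientOn g' u Ω ∧
      ∫⁻ x, g' x ∂μ ≤ ∫⁻ x, g x ∂μ + ε := by
  obtain ⟨Γ, hΓ, hu⟩ := h
  obtain ⟨η, hη, hηsum⟩ := ENNReal.exists_pos_sum_of_countable' hε ℕ
  have hρ : ∀ k, ∃ ρ : X → ℝ≥0∞, Measurable ρ ∧ (∀ γ ∈ Γ, 1 ≤ curveIntegral ρ γ) ∧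
      ∫⁻ x, ρ x ∂μ < η k := by
    intro k
    have : Mod1 μ Γ < η k := hΓ ▸ hη k
    simpa only [Mod1, iInf_lt_iff, exists_prop] using this
  choose ρ hρm hρΓ hρη using hρ
  refine ⟨fun x => g x + ∑' k, ρ k x, hg.add (Measurable.tsum hρm), fun γ hγ => ?_, ?_⟩
  · by_cases hγΓ : γ ∈ Γ
    · have htop : curveIntegral (fun x => g x + ∑' k, ρ k x) γ = ⊤ := by
        refine ENNReal.eq_top_of_forall_nnreal_le fun r => ?_
        obtain ⟨n, hn⟩ := exists_nat_ge r
        calc (r : ℝ≥0∞) ≤ n := by exact_mod_cast hn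
          _ = ∑ k ∈ Finset.range n, 1 := by simp
          _ ≤ ∑ k ∈ Finset.range n, curveIntegral (ρ k) γ :=
            Finset.sum_le_sum fun k _ => hρΓ k γ hγΓ
          _ ≤ _ := sum_curveIntegral_le ρ γ n
          _ ≤ _ := curveIntegral_mono
            (fun x => (ENNReal.sum_le_tsum _).trans le_add_self) γ
      rw [htop]
      exact le_top
    · exact (hu γ hγΓ hγ).trans (curveIntegral_mono (fun x => le_self_add) γ)
  · rw [lintegral_add_left hg, lintegral_tsum fun k => (hρm k).aemeasurable]
    gcongr
    exact (ENNReal.tsum_le_tsum fun k => (hρη k).le).trans hηsum.le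

lemma tv_le_liminf {μ : Measure X} {u : X → ℝ} {Ω : Set X} {v : ℕ → X → ℝ} {g : ℕ → X → ℝ≥0∞}
    (hv : ∀ i, LocLipschitzOn (v i) Ω) (hvu : TendstoL1Loc μ v u Ω) (hg : ∀ i, Measurable (g i))
    (hgv : ∀ i, IsWeakUpperGradientOn μ (g i) (v i) Ω) :
    tv μ u Ω ≤ liminf (fun i => ∫⁻ x in Ω, g i x ∂μ) atTop := by
  unfold tv
  exact iInf₂_le_of_le v hv (iInf₂_le_of_le hvu g (iInf₂_le hg hgv))

lemma tv_mono (μ : Measure X) (u : X → ℝ) {U V : Set X} (hUV : U ⊆ V) : tv μ u U ≤ tv μ u V := by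
  refine le_iInf fun v => le_iInf fun hv => le_iInf fun hvu => le_iInf fun g => le_iInf fun hg =>
    le_iInf fun hgv => ?_
  refine (tv_le_liminf (fun i K hK hKU => hv i K hK (hKU.trans hUV))
    (fun K hK hKU => hvu K hK (hKU.trans hUV)) hg fun i => ?_).trans
    (liminf_le_liminf (Eventually.of_forall fun i => lintegral_mono_set hUV))
  obtain ⟨Γ, hΓ, h⟩ := hgv i
  exact ⟨Γ, hΓ, fun γ hγ hγU => h γ hγ fun t ht => hUV (hγU t ht)⟩

omit [MeasurableSpace X] in
lemma LocLipschitzOn.continuous [ProperSpace X] {v : X → ℝ} (hv : LocLipschitzOn v univ) :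
    Continuous v := by
  refine continuous_iff_continuousAt.2 fun x => ?_
  obtain ⟨L, hL⟩ := hv (closedBall x 1) (isCompact_closedBall x 1) (subset_univ _)
  exact hL.continuousOn.continuousAt (closedBall_mem_nhds x one_pos)

/-- A function with finite total variation is approximated in `L¹` of any ball by locally Lipschitz
functions with upper gradients of almost optimal mass. -/
lemma exists_approx_of_tv_lt [ProperSpace X] {μ : Measure X} {u : X → ℝ} {c : ℝ≥0∞}
    (h : tv μ u univ < c) (x₀ : X) (r : ℝ) {η : ℝ≥0∞} (hη : 0 < η) :
    ∃ (v : X → ℝ) (g : X → ℝ≥0∞), LocLipschitzOn v univ ∧ Measurable g ∧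
      IsUpperGradientOn g v univ ∧ ∫⁻ x, g x ∂μ ≤ c ∧
      ∫⁻ x in closedBall x₀ r, ENNReal.ofReal |v x - u x| ∂μ < η := by
  simp only [tv, iInf_lt_iff] at h
  obtain ⟨v, hv, hvu, g, hg, hgv, hlim⟩ := h
  obtain ⟨i, hi, hi'⟩ := ((frequently_lt_of_liminf_lt (by isBoundedDefault) hlim).and_eventually
    ((hvu (closedBall x₀ r) (isCompact_closedBall x₀ r) (subset_univ _)).eventually_lt_const
      hη)).exists
  rw [Measure.restrict_univ] at hi
  obtain ⟨g', hg', hug, hle⟩ := (hgv i).exists_isUpperGradientOn (hg i) (tsub_pos_of_lt hi).ne'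
  refine ⟨v i, g', hv i, hg', hug, hle.trans ?_, hi'⟩
  rw [add_tsub_cancel_of_le hi.le]

lemma ofReal_abs_sub_le (a b c : ℝ) :
    ENNReal.ofReal |a - c| ≤ ENNReal.ofReal |a - b| + ENNReal.ofReal |b - c| := by
  rw [← ENNReal.ofReal_add (abs_nonneg _) (abs_nonneg _)]
  exact ENNReal.ofReal_le_ofReal (abs_sub_le a b c)

lemma ofReal_abs_sub_comm (a b : ℝ) : ENNReal.ofReal |a - b| = ENNReal.ofReal |b - a| := by
  rw [abs_sub_comm]

namespace MMS

variable {μ : Measure X} {Cd CP lam : ℝ}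

/-- The Poincaré inequality with the average on the right-hand side replaced by an integral. -/
lemma lintegral_sub_average_le (hX : MMS μ Cd CP lam) {v : X → ℝ} {g : X → ℝ≥0∞}
    (hv : LocallyIntegrable v μ) (hg : Measurable g) (hgv : IsUpperGradientOn g v univ)
    (x : X) {r : ℝ} (hr : 0 < r) :
    ∫⁻ y in ball x r, ENNReal.ofReal |v y - ⨍ z in ball x r, v z ∂μ| ∂μ ≤
      ENNReal.ofReal (CP * r) * ∫⁻ y in ball x (lam * r), g y ∂μ := by
  refine (hX.poincare x r hr v hv g hg hgv).trans ?_
  gcongr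
  refine mul_le_of_le_one_right' (ENNReal.div_le_of_le_mul ?_)
  rw [one_mul]
  refine measure_mono (ball_subset_ball ?_)
  nlinarith [hX.hlam]

/-- The average of `v` is controlled by the integral of `|v|`. -/
lemma abs_average_le (hX : MMS μ Cd CP lam) {v : X → ℝ} {x : X} {r : ℝ} (hr : 0 < r) {M : ℝ≥0∞}
    (hM : M ≠ ⊤) (h : ∫⁻ y in ball x r, ENNReal.ofReal |v y| ∂μ ≤ M) :
    |⨍ z in ball x r, v z ∂μ| ≤ (M / μ (ball x r)).toReal := by
  have hpos := (hX.measure_ball_pos x hr).ne'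
  have hM' : M / μ (ball x r) ≠ ⊤ := ENNReal.div_ne_top hM hpos
  rw [← ENNReal.ofReal_le_iff_le_toReal hM', ← Real.enorm_eq_ofReal_abs, average_eq',
    ENNReal.le_div_iff_mul_le (Or.inl hpos) (Or.inl (hX.measure_ball_lt_top x r).ne)]
  refine (mul_le_mul_left (enorm_integral_le_lintegral_enorm _) _).trans ?_
  rw [lintegral_smul_measure, Measure.restrict_apply_univ, smul_eq_mul, mul_comm, ← mul_assoc,
    ENNReal.mul_inv_cancel hpos (hX.measure_ball_lt_top x r).ne, one_mul]
  simpa only [Real.enorm_eq_ofReal_abs] using h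

variable [BorelSpace X]

/-- Total boundedness in `L¹` of a ball of a family of continuous functions bounded in `L¹` of a
larger ball and with upper gradients bounded in `L¹`. -/
lemma exists_finset_lintegral_sub_le (hX : MMS μ Cd CP lam) {v : ℕ → X → ℝ} {g : ℕ → X → ℝ≥0∞}
    (hv : ∀ n, Continuous (v n)) (hg : ∀ n, Measurable (g n))
    (hgv : ∀ n, IsUpperGradientOn (g n) (v n) univ) {M : ℝ≥0∞} (hM : M ≠ ⊤)
    (hgM : ∀ n, ∫⁻ x, g n x ∂μ ≤ M) {x₀ : X} {R : ℝ} (hR : 0 < R) {M' : ℝ≥0∞} (hM' : M' ≠ ⊤)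
    (hvM : ∀ n, ∫⁻ x in closedBall x₀ (R + 1), ENNReal.ofReal |v n x| ∂μ ≤ M')
    {ε : ℝ≥0∞} (hε : ε ≠ 0) :
    ∃ T : Finset ℕ, ∀ n, ∃ m ∈ T,
      ∫⁻ x in closedBall x₀ R, ENNReal.ofReal |v n x - v m x| ∂μ ≤ ε := by
  classical
  have := hX.properSpace
  have := hX.isLocallyFiniteMeasure
  have hε3 : ε / 3 ≠ 0 := (ENNReal.div_pos hε (by simp)).ne'
  obtain ⟨D, hD, hoverlap⟩ := hX.exists_overlap_bound lam
  obtain ⟨s, hs, hsε⟩ := ENNReal.exists_nnreal_pos_mul_lt (ENNReal.mul_ne_top hD hM) hε3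
  have hCP := hX.hCP
  set δ : ℝ := min 1 (s / CP) with hδdef
  have hδ : 0 < δ := lt_min one_pos (div_pos hs hCP)
  have hδ1 : δ ≤ 1 := min_le_left _ _
  have hδs : ENNReal.ofReal (CP * δ) * (D * M) ≤ ε / 3 := by
    refine le_trans ?_ hsε.le
    gcongr
    rw [← ENNReal.ofReal_coe_nnreal]
    refine ENNReal.ofReal_le_ofReal ?_
    calc CP * δ ≤ CP * (s / CP) := by gcongr; exact min_le_right _ _
      _ = s := by field_simp
  obtain ⟨J, hJs, hJ, hcov⟩ := hX.exists_finite_net x₀ hR hδ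
  set c : ℕ → J → ℝ := fun n x => ⨍ z in ball (x : X) δ, v n z ∂μ with hc
  have hpoinc : ∀ n, ∑ x : J, ∫⁻ y in ball (x : X) δ, ENNReal.ofReal |v n y - c n x| ∂μ ≤ ε / 3 := by
    intro n
    calc ∑ x : J, ∫⁻ y in ball (x : X) δ, ENNReal.ofReal |v n y - c n x| ∂μ
        ≤ ∑ x : J, ENNReal.ofReal (CP * δ) * ∫⁻ y in ball (x : X) (lam * δ), g n y ∂μ :=
          Finset.sum_le_sum fun x _ => hX.lintegral_sub_average_le (hv n).locallyIntegrable
            (hg n) (hgv n) x hδ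
      _ = ENNReal.ofReal (CP * δ) * ∑ x ∈ J, ∫⁻ y in ball x (lam * δ), g n y ∂μ := by
          rw [← Finset.mul_sum,
            Finset.sum_coe_sort J fun x => ∫⁻ y in ball x (lam * δ), g n y ∂μ]
      _ ≤ ENNReal.ofReal (CP * δ) * (D * M) := by
          gcongr
          exact (hoverlap J δ hδ hJ (g n) (hg n)).trans (by gcongr; exact hgM n)
      _ ≤ ε / 3 := hδs
  set K : J → ℝ := fun x => (M' / μ (ball (x : X) δ)).toReal
  have hrange : range c ⊆ Icc (-K) K := by
    rintro _ ⟨n, rfl⟩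
    have hcK : ∀ x, |c n x| ≤ K x := fun x => hX.abs_average_le hδ hM'
      ((lintegral_mono_set (ball_subset_closedBall.trans (closedBall_subset_closedBall' (by
        have := mem_closedBall.1 (hJs x.2)
        linarith)))).trans (hvM n))
    exact ⟨fun x => (abs_le.1 (hcK x)).1, fun x => (abs_le.1 (hcK x)).2⟩
  have hSfin : ∑ x : J, μ (ball (x : X) δ) ≠ ⊤ :=
    ENNReal.sum_ne_top.2 fun x _ => (hX.measure_ball_lt_top x δ).ne
  obtain ⟨η, hη, hηε⟩ := ENNReal.exists_nnreal_pos_mul_lt hSfin hε3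
  obtain ⟨t, htr, htfin, ht⟩ := Metric.finite_approx_of_totallyBounded
    (isCompact_Icc.totallyBounded.subset hrange) (η : ℝ) hη
  choose! k hk using fun y (hy : y ∈ t) => htr hy
  refine ⟨htfin.toFinset.image k, fun n => ?_⟩
  obtain ⟨y, hyt, hny⟩ := mem_iUnion₂.1 (ht (mem_range_self n))
  refine ⟨k y, Finset.mem_image_of_mem k (htfin.mem_toFinset.2 hyt), ?_⟩
  set m := k y
  have hcm : c m = y := hk y hyt
  rw [← hcm] at hny
  have hcnm : ∀ x, ENNReal.ofReal |c n x - c m x| ≤ η := by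
    intro x
    rw [← ENNReal.ofReal_coe_nnreal, ← Real.dist_eq]
    exact ENNReal.ofReal_le_ofReal ((dist_le_pi_dist _ _ x).trans (mem_ball.1 hny).le)
  have hmeas : ∀ n x, Measurable fun y => ENNReal.ofReal |v n y - c n x| := fun n x =>
    (((hv n).sub continuous_const).abs.measurable).ennreal_ofReal
  calc ∫⁻ y in closedBall x₀ R, ENNReal.ofReal |v n y - v m y| ∂μ
      ≤ ∫⁻ y in ⋃ x : J, ball (x : X) δ, ENNReal.ofReal |v n y - v m y| ∂μ := by
        refine lintegral_mono_set (hcov.trans (iUnion₂_subset fun x hx => ?_))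
        exact subset_iUnion (fun x : J => ball (x : X) δ) ⟨x, hx⟩
    _ ≤ ∑ x : J, ∫⁻ y in ball (x : X) δ, ENNReal.ofReal |v n y - v m y| ∂μ :=
        (lintegral_iUnion_le _ _).trans_eq (tsum_fintype _)
    _ ≤ ∑ x : J, (∫⁻ y in ball (x : X) δ, ENNReal.ofReal |v n y - c n x| ∂μ +
          ∫⁻ y in ball (x : X) δ, ENNReal.ofReal |v m y - c m x| ∂μ +
          η * μ (ball (x : X) δ)) := by
        refine Finset.sum_le_sum fun x _ => ?_
        rw [← setLIntegral_const, ← lintegral_add_left (hmeas n x),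
          ← lintegral_add_left (by exact (hmeas n x).add (hmeas m x))]
        refine lintegral_mono fun y => ?_
        refine (ofReal_abs_sub_le _ (c n x) _).trans ?_
        rw [add_assoc]
        gcongr
        refine (ofReal_abs_sub_le _ (c m x) _).trans ?_
        rw [add_comm, ofReal_abs_sub_comm (c m x)]
        gcongr
        exact hcnm x
    _ ≤ ε / 3 + ε / 3 + ε / 3 := by
        rw [Finset.sum_add_distrib, Finset.sum_add_distrib, ← Finset.mul_sum]
        exact add_le_add (add_le_add (hpoinc n) (hpoinc m)) hηε.le
    _ = ε := ENNReal.add_thirds ε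

end MMS

omit [MetricSpace X] in
/-- A sequence whose range is totally bounded in `L¹` has a subsequence converging in `L¹`. -/
lemma exists_subseq_tendsto_lintegral_sub {ν : Measure X} {v : ℕ → X → ℝ}
    (hv : ∀ n, Integrable (v n) ν)
    (h : ∀ ε : ℝ≥0∞, ε ≠ 0 → ∃ T : Finset ℕ, ∀ n, ∃ m ∈ T,
      ∫⁻ x, ENNReal.ofReal |v n x - v m x| ∂ν ≤ ε) :
    ∃ (φ : ℕ → ℕ) (w : X → ℝ), StrictMono φ ∧ Integrable w ν ∧
      Tendsto (fun k => ∫⁻ x, ENNReal.ofReal |v (φ k) x - w x| ∂ν) atTop (𝓝 0) := by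
  have hed : ∀ a b : ℝ, edist a b = ENNReal.ofReal |a - b| := fun a b => by
    rw [edist_dist, Real.dist_eq]
  set F : ℕ → (X →₁[ν] ℝ) := fun n => (hv n).toL1 (v n)
  have hF : TotallyBounded (range F) := by
    refine EMetric.totallyBounded_iff.2 fun ε hε => ?_
    obtain ⟨ε', hε', hlt⟩ := exists_between hε
    obtain ⟨T, hT⟩ := h ε' hε'.ne'
    refine ⟨F '' T, T.finite_toSet.image F, ?_⟩
    rintro _ ⟨n, rfl⟩
    obtain ⟨m, hm, hnm⟩ := hT n
    refine mem_iUnion₂.2 ⟨F m, mem_image_of_mem F hm, lt_of_le_of_lt ?_ hlt⟩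
    rw [Integrable.edist_toL1_toL1]
    simpa only [hed] using hnm
  obtain ⟨w, -, φ, hφ, hlim⟩ := (isCompact_iff_totallyBounded_isComplete.2
    ⟨hF.closure, isClosed_closure.isComplete⟩).tendsto_subseq fun n => subset_closure (mem_range_self n)
  refine ⟨φ, w, hφ, L1.integrable_coeFn w, ?_⟩
  refine (tendsto_iff_edist_tendsto_0.1 hlim).congr fun k => ?_
  rw [Function.comp_apply, L1.edist_def]
  refine lintegral_congr_ae ?_
  filter_upwards [(hv (φ k)).coeFn_toL1] with x hx
  rw [hx, hed]

lemma MemBVloc.locallyIntegrable {μ : Measure X} {u : X → ℝ} (h : MemBVloc μ u univ) :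
    LocallyIntegrable u μ := by
  intro x
  obtain ⟨U, hU, hxU, -, hu⟩ := h {x} isCompact_singleton (subset_univ _)
  exact ⟨U, hU.mem_nhds (hxU rfl), hu.1⟩

omit [MetricSpace X] in
/-- A function is bounded in `L¹(B)` by its oscillation in `B` and its integral over a subset. -/
lemma lintegral_abs_le_of_oscillation {μ : Measure X} {A B : Set X} (hAB : A ⊆ B)
    (hA : μ A ≠ 0) (hA' : μ A ≠ ⊤) {v : X → ℝ} (hv : AEMeasurable v μ) (a : ℝ) {C₁ C₂ : ℝ≥0∞}
    (h₁ : ∫⁻ x in B, ENNReal.ofReal |v x - a| ∂μ ≤ C₁)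
    (h₂ : ∫⁻ x in A, ENNReal.ofReal |v x| ∂μ ≤ C₂) :
    ∫⁻ x in B, ENNReal.ofReal |v x| ∂μ ≤ C₁ + (C₁ + C₂) / μ A * μ B := by
  have hm : ∀ s : Set X, AEMeasurable (fun x => ENNReal.ofReal |v x - a|) (μ.restrict s) :=
    fun s => (hv.sub_const a).norm.ennreal_ofReal.restrict
  have ha : ENNReal.ofReal |a| ≤ (C₁ + C₂) / μ A := by
    rw [ENNReal.le_div_iff_mul_le (Or.inl hA) (Or.inl hA'), ← setLIntegral_const]
    calc ∫⁻ _ in A, ENNReal.ofReal |a| ∂μ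
        ≤ ∫⁻ x in A, (ENNReal.ofReal |v x - a| + ENNReal.ofReal |v x|) ∂μ := by
          refine lintegral_mono fun x => ?_
          simpa [abs_sub_comm a] using ofReal_abs_sub_le a (v x) 0
      _ ≤ C₁ + C₂ := by
          rw [lintegral_add_left' (hm A)]
          exact add_le_add ((lintegral_mono_set hAB).trans h₁) h₂
  calc ∫⁻ x in B, ENNReal.ofReal |v x| ∂μ
      ≤ ∫⁻ x in B, (ENNReal.ofReal |v x - a| + ENNReal.ofReal |a|) ∂μ := by
        refine lintegral_mono fun x => ?_
        simpa using ofReal_abs_sub_le (v x) a 0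
    _ ≤ C₁ + (C₁ + C₂) / μ A * μ B := by
        rw [lintegral_add_left' (hm B), setLIntegral_const]
        gcongr

omit [MeasurableSpace X] in
lemma exists_disjoint_ball_of_ediam_lt {Ω : Set X} (hne : Ω.Nonempty)
    (hdiam : Metric.ediam Ω < Metric.ediam (univ : Set X) / 4) :
    ∃ (y : X) (δ : ℝ), 0 < δ ∧ Disjoint (ball y δ) Ω := by
  obtain ⟨x₀, hx₀⟩ := hne
  suffices h : ∃ y, Metric.ediam Ω < edist x₀ y by
    obtain ⟨y, hy⟩ := h
    have hyΩ : y ∉ closure Ω := fun hmem => hy.not_ge <| by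
      rw [← Metric.ediam_closure]
      exact Metric.edist_le_ediam_of_mem (subset_closure hx₀) hmem
    obtain ⟨δ, hδ, hball⟩ := Metric.isOpen_iff.1 isClosed_closure.isOpen_compl y hyΩ
    exact ⟨y, δ, hδ, (disjoint_compl_left.mono_left hball).mono_right subset_closure⟩
  by_contra! h
  have h2 : Metric.ediam (univ : Set X) ≤ 2 * Metric.ediam Ω := by
    refine Metric.ediam_le fun x _ y _ => ?_
    rw [two_mul]
    exact (edist_triangle_left x y x₀).trans (add_le_add (h x) (h y))
  rw [ENNReal.lt_div_iff_mul_lt (by simp) (by simp)] at hdiam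
  have : Metric.ediam Ω * 4 < Metric.ediam Ω * 4 := by
    refine hdiam.trans_le (h2.trans ?_)
    rw [mul_comm]
    gcongr
    norm_num
  exact this.false

omit [MeasurableSpace X] in
lemma exists_closedBall_superset {K : Set X} (hK : IsCompact K) (x₀ : X) :
    ∃ ρ, K ⊆ closedBall x₀ ρ :=
  hK.isBounded.subset_closedBall x₀

/-- A sequence of approximants of functions agreeing with `f` outside `Ω`, with bounded energies,
has a subsequence along which both the approximants and the functions converge. -/
lemma MMS.exists_subseq_tendsto_of_eq_outside [BorelSpace X] {μ : Measure X} {Cd CP lam : ℝ}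
    (hX : MMS μ Cd CP lam) {Ω : Set X} (hΩ : MeasurableSet Ω) {x₀ y : X} {R r δ : ℝ} (hR : 0 < R)
    (hΩR : Ω ⊆ closedBall x₀ R) (hRr : R + 1 < r) (hδ : 0 < δ) (hyΩ : Disjoint (ball y δ) Ω)
    (hyr : ball y δ ⊆ ball x₀ r) {f : X → ℝ} (hf : LocallyIntegrable f μ)
    {u v : ℕ → X → ℝ} {g : ℕ → X → ℝ≥0∞} (hu : ∀ n, AEMeasurable (u n) μ)
    (huf : ∀ n, ∀ᵐ x ∂μ, x ∉ Ω → u n x = f x) (hv : ∀ n, Continuous (v n))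
    (hg : ∀ n, Measurable (g n)) (hgv : ∀ n, IsUpperGradientOn (g n) (v n) univ)
    {M : ℝ≥0∞} (hM : M ≠ ⊤) (hgM : ∀ n, ∫⁻ x, g n x ∂μ ≤ M)
    {η : ℕ → ℝ≥0∞} (hη1 : ∀ n, η n ≤ 1) (hη : Tendsto η atTop (𝓝 0))
    (huv : ∀ n : ℕ, ∫⁻ x in closedBall x₀ (r + n), ENNReal.ofReal |v n x - u n x| ∂μ ≤ η n) :
    ∃ (φ : ℕ → ℕ) (w : X → ℝ), StrictMono φ ∧ IntegrableOn w Ω μ ∧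
      Tendsto (fun k => ∫⁻ x in Ω, ENNReal.ofReal |u (φ k) x - w x| ∂μ) atTop (𝓝 0) ∧
      ∀ w' : X → ℝ, EqOn w' w Ω → EqOn w' f Ωᶜ →
        TendstoL1Loc μ (fun k => v (φ k)) w' univ := by
  have := hX.properSpace
  have := hX.isLocallyFiniteMeasure
  have hr : 0 < r := by linarith
  have hsub : ∀ n : ℕ, ball x₀ r ⊆ closedBall x₀ (r + n) := fun n =>
    ball_subset_closedBall.trans (closedBall_subset_closedBall (by simp))
  have hA := (hX.measure_ball_pos y hδ).ne'
  have hA' := (hX.measure_ball_lt_top y δ).ne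
  set C₁ := ENNReal.ofReal (CP * r) * M
  have hC₁ : C₁ ≠ ⊤ := ENNReal.mul_ne_top ENNReal.ofReal_ne_top hM
  set C₂ := 1 + ∫⁻ x in ball y δ, ENNReal.ofReal |f x| ∂μ
  have hC₂ : C₂ ≠ ⊤ := by
    refine ENNReal.add_ne_top.2 ⟨ENNReal.one_ne_top, ?_⟩
    have := ((hf.integrableOn_isCompact (isCompact_closedBall y δ)).mono_set
      ball_subset_closedBall).2
    simpa only [HasFiniteIntegral, Real.enorm_eq_ofReal_abs] using this.ne
  have hmuv : ∀ n, AEMeasurable (fun x => ENNReal.ofReal |v n x - u n x|) μ := fun n =>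
    ((hv n).measurable.aemeasurable.sub (hu n)).norm.ennreal_ofReal
  have hvA : ∀ n, ∫⁻ x in ball y δ, ENNReal.ofReal |v n x| ∂μ ≤ C₂ := by
    intro n
    calc ∫⁻ x in ball y δ, ENNReal.ofReal |v n x| ∂μ
        ≤ ∫⁻ x in ball y δ, (ENNReal.ofReal |v n x - u n x| + ENNReal.ofReal |f x|) ∂μ := by
          refine setLIntegral_mono_ae' measurableSet_ball ?_
          filter_upwards [huf n] with x hx hxy
          rw [← hx (hyΩ.notMem_of_mem_left hxy)]
          simpa using ofReal_abs_sub_le (v n x) (u n x) 0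
      _ ≤ C₂ := by
          rw [lintegral_add_left' (hmuv n).restrict]
          exact add_le_add
            (((lintegral_mono_set (hyr.trans (hsub n))).trans (huv n)).trans (hη1 n)) le_rfl
  have hvB : ∀ n, ∫⁻ x in ball x₀ r, ENNReal.ofReal |v n x| ∂μ ≤
      C₁ + (C₁ + C₂) / μ (ball y δ) * μ (ball x₀ r) := fun n =>
    lintegral_abs_le_of_oscillation hyr hA hA' (hv n).measurable.aemeasurable _
      ((hX.lintegral_sub_average_le (hv n).locallyIntegrable (hg n) (hgv n) x₀ hr).trans
        (mul_le_mul' le_rfl ((setLIntegral_le_lintegral _ _).trans (hgM n)))) (hvA n)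
  have hbound : C₁ + (C₁ + C₂) / μ (ball y δ) * μ (ball x₀ r) ≠ ⊤ :=
    ENNReal.add_ne_top.2 ⟨hC₁, ENNReal.mul_ne_top
      (ENNReal.div_ne_top (ENNReal.add_ne_top.2 ⟨hC₁, hC₂⟩) hA)
      (hX.measure_ball_lt_top x₀ r).ne⟩
  have hRsub : closedBall x₀ R ⊆ ball x₀ r := closedBall_subset_ball (by linarith)
  obtain ⟨φ, w, hφ, hw, hlim⟩ := exists_subseq_tendsto_lintegral_sub
    (ν := μ.restrict (closedBall x₀ R)) (v := v)
    (fun n => (hv n).locallyIntegrable.integrableOn_isCompact (isCompact_closedBall x₀ R))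
    (fun ε hε => hX.exists_finset_lintegral_sub_le hv hg hgv hM hgM hR hbound
      (fun n => (lintegral_mono_set (closedBall_subset_ball hRr)).trans (hvB n)) hε)
  have hηφ : Tendsto (fun k => η (φ k)) atTop (𝓝 0) := hη.comp hφ.tendsto_atTop
  have huw : Tendsto (fun k => ∫⁻ x in Ω, ENNReal.ofReal |u (φ k) x - w x| ∂μ) atTop (𝓝 0) := by
    have hsum := hηφ.add hlim
    rw [add_zero] at hsum
    refine tendsto_of_tendsto_of_tendsto_of_le_of_le tendsto_const_nhds hsum
      (fun _ => zero_le) fun k => ?_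
    calc ∫⁻ x in Ω, ENNReal.ofReal |u (φ k) x - w x| ∂μ
        ≤ ∫⁻ x in closedBall x₀ R, ENNReal.ofReal |u (φ k) x - w x| ∂μ := lintegral_mono_set hΩR
      _ ≤ ∫⁻ x in closedBall x₀ R, (ENNReal.ofReal |v (φ k) x - u (φ k) x| +
            ENNReal.ofReal |v (φ k) x - w x|) ∂μ := by
          refine lintegral_mono fun x => ?_
          rw [ofReal_abs_sub_comm (v (φ k) x) (u (φ k) x)]
          exact ofReal_abs_sub_le _ _ _
      _ ≤ η (φ k) + ∫⁻ x in closedBall x₀ R, ENNReal.ofReal |v (φ k) x - w x| ∂μ := by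
          rw [lintegral_add_left' (hmuv _).restrict]
          gcongr
          exact (lintegral_mono_set (hRsub.trans (hsub _))).trans (huv _)
  refine ⟨φ, w, hφ, IntegrableOn.mono_set hw hΩR, huw, fun w' hw'Ω hw'f K hK _ => ?_⟩
  obtain ⟨ρ, hρ⟩ := exists_closedBall_superset hK x₀
  have hsum := hηφ.add huw
  rw [add_zero] at hsum
  refine tendsto_of_tendsto_of_tendsto_of_le_of_le' tendsto_const_nhds hsum
    (Eventually.of_forall fun _ => zero_le) ?_
  filter_upwards [hφ.tendsto_atTop.eventually_ge_atTop ⌈ρ⌉₊] with k hk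
  have hKk : K ⊆ closedBall x₀ (r + φ k) := by
    refine hρ.trans (closedBall_subset_closedBall ?_)
    have := Nat.ceil_le.1 hk
    linarith
  calc ∫⁻ x in K, ENNReal.ofReal |v (φ k) x - w' x| ∂μ
      ≤ ∫⁻ x in closedBall x₀ (r + φ k), ENNReal.ofReal |v (φ k) x - w' x| ∂μ :=
        lintegral_mono_set hKk
    _ ≤ ∫⁻ x in closedBall x₀ (r + φ k), (ENNReal.ofReal |v (φ k) x - u (φ k) x| +
          Ω.indicator (fun x => ENNReal.ofReal |u (φ k) x - w x|) x) ∂μ := by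
        refine lintegral_mono_ae (ae_restrict_of_ae ?_)
        filter_upwards [huf (φ k)] with x hx
        by_cases hxΩ : x ∈ Ω
        · rw [indicator_of_mem hxΩ, hw'Ω hxΩ]
          exact ofReal_abs_sub_le _ _ _
        · rw [indicator_of_notMem hxΩ, hw'f hxΩ, hx hxΩ, add_zero]
    _ ≤ η (φ k) + ∫⁻ x in Ω, ENNReal.ofReal |u (φ k) x - w x| ∂μ := by
        rw [lintegral_add_left' (hmuv _).restrict, ← lintegral_indicator hΩ]
        exact add_le_add (huv _) (setLIntegral_le_lintegral _ _)

omit [MetricSpace X] in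
lemma exists_subseq_ae_tendsto_of_lintegral_sub {ν : Measure X} {u : ℕ → X → ℝ} {w : X → ℝ}
    (hu : ∀ n, AEMeasurable (u n) ν) (hw : AEMeasurable w ν)
    (h : Tendsto (fun k => ∫⁻ x, ENNReal.ofReal |u k x - w x| ∂ν) atTop (𝓝 0)) :
    ∃ ns : ℕ → ℕ, StrictMono ns ∧ ∀ᵐ x ∂ν, Tendsto (fun k => u (ns k) x) atTop (𝓝 (w x)) := by
  refine (tendstoInMeasure_of_tendsto_eLpNorm (p := 1) one_ne_zero
    (fun n => (hu n).aestronglyMeasurable) hw.aestronglyMeasurable ?_).exists_seq_tendsto_ae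
  simpa only [eLpNorm_one_eq_lintegral_enorm, Pi.sub_apply, Real.enorm_eq_ofReal_abs] using h

/-- **Existence of solutions of the obstacle problem.** If `Ω` is a nonempty bounded open set
with `diam Ω < (1/4) diam X` and `K_{ψ,f}(Ω) ≠ ∅`, then there exists a solution of the
`K_{ψ,f}(Ω)`-obstacle problem. -/
theorem obstacle_problem_existence
    {X : Type*} [MetricSpace X] [MeasurableSpace X] [BorelSpace X]
    (μ : Measure X) (Cd CP lam : ℝ) (hX : MMS μ Cd CP lam)
    (Ω : Set X) (hΩopen : IsOpen Ω) (hΩne : Ω.Nonempty) (hΩbdd : Bornology.IsBounded Ω)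
    (hdiam : EMetric.diam Ω < EMetric.diam (Set.univ : Set X) / 4)
    (ψ : X → EReal) (f : X → ℝ)
    (hf : MeasureTheory.LocallyIntegrable f μ) (hDf : tv μ f Set.univ < ⊤)
    (hKne : ∃ u : X → ℝ, MemK μ ψ f Ω u) :
    ∃ u : X → ℝ, IsObstacleSolution μ ψ f Ω u := by
  classical
  set m : ℝ≥0∞ := ⨅ (v : X → ℝ) (_ : MemK μ ψ f Ω v), tv μ v univ
  have hm : ∀ v, MemK μ ψ f Ω v → m ≤ tv μ v univ := fun v hv => iInf₂_le v hv
  rcases eq_or_ne m ⊤ with hmtop | hmtop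
  · obtain ⟨u, hu⟩ := hKne
    exact ⟨u, hu, fun v hv => le_top.trans (hmtop ▸ hm v hv)⟩
  have := hX.properSpace
  have := hX.isLocallyFiniteMeasure
  obtain ⟨x₀, hx₀⟩ := hΩne
  obtain ⟨y, δ, hδ, hyΩ⟩ := exists_disjoint_ball_of_ediam_lt ⟨x₀, hx₀⟩ hdiam
  obtain ⟨R, hR, hΩR⟩ := hΩbdd.subset_closedBall_lt 0 x₀
  set r : ℝ := max (R + 2) (dist y x₀ + δ)
  have hRr : R + 1 < r := lt_max_of_lt_left (by linarith)
  have hyr : ball y δ ⊆ ball x₀ r :=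
    ball_subset_ball' (by rw [add_comm]; exact le_max_right _ _)
  set η : ℕ → ℝ≥0∞ := fun n => ((n + 1 : ℕ) : ℝ≥0∞)⁻¹
  have hη0 : ∀ n, 0 < η n := fun n => ENNReal.inv_pos.2 (ENNReal.natCast_ne_top _)
  have hη1 : ∀ n, η n ≤ 1 := fun n => ENNReal.inv_le_one.2 (by simp)
  have hη : Tendsto η atTop (𝓝 0) :=
    ENNReal.tendsto_inv_nat_nhds_zero.comp (tendsto_add_atTop_nat 1)
  have hseq : ∀ n, ∃ u, MemK μ ψ f Ω u ∧ tv μ u univ < m + η n := by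
    intro n
    have : m < m + η n := ENNReal.lt_add_right hmtop (hη0 n).ne'
    simpa only [m, iInf_lt_iff, exists_prop] using this
  choose u huK hutv using hseq
  choose v g hv hg hgv hgm huv using fun n : ℕ =>
    exists_approx_of_tv_lt (hutv n) x₀ (r + n) (hη0 n)
  have hum : ∀ n, AEMeasurable (u n) μ := fun n =>
    (huK n).1.locallyIntegrable.aestronglyMeasurable.aemeasurable
  obtain ⟨φ, w, hφ, hw, huw, hlim⟩ := hX.exists_subseq_tendsto_of_eq_outside hΩopen.measurableSet
    hR hΩR hRr hδ hyΩ hyr hf hum (fun n => (huK n).2.2) (fun n => (hv n).continuous) hg hgv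
    (ENNReal.add_ne_top.2 ⟨hmtop, ENNReal.one_ne_top⟩)
    (fun n => (hgm n).trans (by gcongr; exact hη1 n)) hη1 hη (fun n => (huv n).le)
  set z : X → ℝ := Ω.piecewise w f
  have hz : tv μ z univ ≤ m := by
    refine (tv_le_liminf (fun k => hv (φ k)) (hlim z (piecewise_eqOn Ω w f)
      (piecewise_eqOn_compl Ω w f)) (fun k => hg (φ k))
      fun k => (hgv (φ k)).isWeakUpperGradientOn).trans ?_
    have htend : Tendsto (fun k => m + η (φ k)) atTop (𝓝 m) := by
      simpa using tendsto_const_nhds.add (hη.comp hφ.tendsto_atTop)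
    rw [← htend.liminf_eq]
    refine liminf_le_liminf (Eventually.of_forall fun k => ?_)
    rw [Measure.restrict_univ]
    exact hgm (φ k)
  refine ⟨z, ⟨fun K hK _ => ?_, ?_, ?_⟩, fun v hv => hz.trans (hm v hv)⟩
  · obtain ⟨ρ, hρ⟩ := exists_closedBall_superset hK x₀
    refine ⟨ball x₀ (ρ + 1), isOpen_ball, hρ.trans (closedBall_subset_ball (by linarith)),
      subset_univ _, ?_, ((tv_mono μ z (subset_univ _)).trans hz).trans_lt hmtop.lt_top⟩
    have hfb : IntegrableOn f (ball x₀ (ρ + 1)) μ :=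
      (hf.integrableOn_isCompact (isCompact_closedBall x₀ (ρ + 1))).mono_set
        ball_subset_closedBall
    refine Integrable.piecewise hΩopen.measurableSet ?_ hfb.integrableOn
    rw [IntegrableOn, Measure.restrict_restrict hΩopen.measurableSet]
    exact hw.mono_set inter_subset_left
  · obtain ⟨ns, hns, hae⟩ := exists_subseq_ae_tendsto_of_lintegral_sub
      (fun k => (hum (φ k)).restrict) hw.1.aemeasurable huw
    have hψ : ∀ᵐ x ∂μ, ∀ n, x ∈ Ω → ψ x ≤ (u n x : EReal) := ae_all_iff.2 fun n => (huK n).2.1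
    filter_upwards [hψ, (ae_restrict_iff' hΩopen.measurableSet).1 hae] with x hxψ hx hxΩ
    have hzx : z x = w x := piecewise_eq_of_mem _ _ _ hxΩ
    rw [hzx]
    exact ge_of_tendsto' ((continuous_coe_real_ereal.tendsto _).comp (hx hxΩ))
      fun k => hxψ _ hxΩ
  · exact Eventually.of_forall fun x hx => piecewise_eq_of_notMem _ _ _ hx

end MetricBV
end
end

section
/- Let Ω ⊂ X be a nonempty bounded open set and A ⊂ X. If there exists a solution of the K_{χ_A,0}(Ω)-obstacle problem (obstacle ψ = χ_A, boundary data f = 0), then there exists a set E ⊂ X such that the characteristic function χ_E is also a solution of this obstacle problem. -/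
open MeasureTheory Metric Filter Set
open scoped ENNReal NNReal Topology

noncomputable section

namespace MetricBV

variable {X : Type*} [MetricSpace X] [MeasurableSpace X]

lemma MMS.measure_ball_le {μ : Measure X} {Cd CP lam : ℝ} (hX : MMS μ Cd CP lam) (x : X)
    {r : ℝ} (hr : 0 < r) (k : ℕ) :
    μ (ball x (2 ^ k * r)) ≤ ENNReal.ofReal Cd ^ k * μ (ball x r) := by
  induction k with
  | zero => simp
  | succ k ih =>
    calc μ (ball x (2 ^ (k + 1) * r)) = μ (ball x (2 * (2 ^ k * r))) := by
          congr 2; ring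
      _ ≤ ENNReal.ofReal Cd * μ (ball x (2 ^ k * r)) := (hX.doubling x _ (by positivity)).2.1
      _ ≤ ENNReal.ofReal Cd * (ENNReal.ofReal Cd ^ k * μ (ball x r)) := by gcongr
      _ = _ := by ring

lemma MMS.measure_ball_pos_s3 {μ : Measure X} {Cd CP lam : ℝ} (hX : MMS μ Cd CP lam) (x : X)
    {r : ℝ} (hr : 0 < r) : 0 < μ (ball x r) := by
  have := (hX.doubling x (r / 2) (by positivity)).1
  rwa [mul_div_cancel₀ r two_ne_zero] at this

lemma MMS.isLocallyFiniteMeasure_s3 {μ : Measure X} {Cd CP lam : ℝ} (hX : MMS μ Cd CP lam) :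
    IsLocallyFiniteMeasure μ :=
  ⟨fun x => ⟨ball x 1, ball_mem_nhds x one_pos, (hX.doubling x 1 one_pos).2.2⟩⟩

lemma MMS.totallyBounded_closedBall [BorelSpace X] {μ : Measure X} {Cd CP lam : ℝ}
    (hX : MMS μ Cd CP lam) (x : X) {R : ℝ} (hR : 0 < R) : TotallyBounded (closedBall x R) := by
  rw [Metric.totallyBounded_iff]
  by_contra! hcon
  obtain ⟨ε, hε, hcover⟩ := hcon
  have : Std.Symm fun a b : X => ε ≤ dist a b := ⟨fun a b h => by rwa [dist_comm]⟩
  obtain ⟨f, hfmem, hfsep⟩ := exists_seq_of_forall_finset_exists'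
    (fun y => y ∈ closedBall x R) (fun a b => ε ≤ dist a b) (fun s _ => by
      obtain ⟨y, hy, hy'⟩ := Set.not_subset.1 (hcover s s.finite_toSet)
      refine ⟨y, hy, fun z hz => ?_⟩
      by_contra! h
      exact hy' (mem_iUnion₂.2 ⟨z, hz, by rwa [mem_ball, dist_comm]⟩))
  obtain ⟨k, hk⟩ := pow_unbounded_of_one_lt (2 * R / (ε / 2)) (one_lt_two (α := ℝ))
  rw [div_lt_iff₀ (by positivity)] at hk
  have hCk : ENNReal.ofReal Cd ^ k ≠ ∞ := by finiteness
  have hCk0 : ENNReal.ofReal Cd ^ k ≠ 0 :=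
    pow_ne_zero _ (ENNReal.ofReal_pos.2 (by linarith [hX.hCd])).ne'
  have hlower : ∀ n, μ (ball x R) / ENNReal.ofReal Cd ^ k ≤ μ (ball (f n) (ε / 2)) := by
    intro n
    rw [ENNReal.div_le_iff hCk0 hCk, mul_comm]
    refine (measure_mono fun y hy => ?_).trans
      (hX.measure_ball_le (f n) (half_pos hε) k)
    have h1 := mem_closedBall.1 (hfmem n)
    have h2 := mem_ball.1 hy
    rw [mem_ball]
    linarith [dist_triangle_right y (f n) x]
  have hfin := Measure.finite_const_le_meas_of_disjoint_iUnion μ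
    (ENNReal.div_pos (hX.measure_ball_pos_s3 x hR).ne' hCk)
    (As := fun n => ball (f n) (ε / 2)) (fun _ => measurableSet_ball)
    (fun m n hmn => ball_disjoint_ball (by linarith [hfsep hmn]))
    (ne_top_of_le_ne_top (hX.doubling x (R + ε) (by positivity)).2.2.ne
      (measure_mono (iUnion_subset fun n =>
        ball_subset_ball' (by linarith [mem_closedBall.1 (hfmem n)]))))
  exact Set.infinite_univ (hfin.subset fun n _ => hlower n)

lemma MMS.properSpace_s3 [BorelSpace X] {μ : Measure X} {Cd CP lam : ℝ}
    (hX : MMS μ Cd CP lam) : ProperSpace X := by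
  have := hX.complete
  exact ProperSpace.of_isCompact_closedBall_of_le 1 fun x r hr =>
    isCompact_iff_totallyBounded_isComplete.2
      ⟨hX.totallyBounded_closedBall x (by linarith), isClosed_closedBall.isComplete⟩

/-- The affinely reparametrized restriction of a curve to a subinterval of `[0,1]`. -/
def Curve.sub (γ : Curve X) {a b : ℝ} (ha : 0 ≤ a) (hab : a < b) (hb : b ≤ 1) : Curve X where
  toFun s := γ.toFun (a + (b - a) * s)
  lipschitz := by
    obtain ⟨K, hK⟩ := γ.lipschitz
    refine ⟨K * Real.toNNReal (b - a), LipschitzOnWith.of_dist_le_mul fun s hs t ht => ?_⟩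
    have hmem : ∀ s ∈ Icc (0 : ℝ) 1, a + (b - a) * s ∈ Icc (0 : ℝ) 1 := fun s hs =>
      ⟨by nlinarith [hs.1], by nlinarith [hs.2]⟩
    refine (hK.dist_le_mul _ (hmem s hs) _ (hmem t ht)).trans_eq ?_
    rw [NNReal.coe_mul, Real.coe_toNNReal _ (by linarith), Real.dist_eq, Real.dist_eq,
      show a + (b - a) * s - (a + (b - a) * t) = (b - a) * (s - t) by ring, abs_mul,
      abs_of_pos (by linarith : 0 < b - a)]
    ring

lemma affine_mem_Icc {a b s : ℝ} (hab : a < b) (hs : s ∈ Icc (0 : ℝ) 1) :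
    a + (b - a) * s ∈ Icc a b :=
  ⟨by nlinarith [hs.1], by nlinarith [hs.2]⟩

lemma image_affine_Icc {a b : ℝ} (hab : a < b) :
    (fun s => a + (b - a) * s) '' Icc (0 : ℝ) 1 = Icc a b := by
  refine Subset.antisymm (image_subset_iff.2 fun s hs => affine_mem_Icc hab hs) fun t ht => ?_
  have h : 0 < b - a := by linarith
  refine ⟨(t - a) / (b - a), ⟨div_nonneg (by linarith [ht.1]) h.le, ?_⟩, ?_⟩
  · rw [div_le_one h]; linarith [ht.2]
  · field_simp; ring

lemma speed_comp_affine {Y : Type*} [MetricSpace Y] (γ : ℝ → Y) {a c : ℝ} (hc : 0 < c) (s : ℝ) :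
    speed (fun s => γ (a + c * s)) s = ENNReal.ofReal c * speed γ (a + c * s) := by
  have hmap : Filter.map (fun h : ℝ => c * h) (𝓝[≠] (0 : ℝ)) = 𝓝[≠] (0 : ℝ) := by
    have := (Homeomorph.mulLeft₀ c hc.ne').isEmbedding.map_nhdsWithin_eq {(0 : ℝ)}ᶜ 0
    rw [Set.image_compl_eq (Homeomorph.mulLeft₀ c hc.ne').bijective] at this
    simpa using this
  unfold speed
  rw [← ENNReal.limsup_const_mul_of_ne_top ENNReal.ofReal_ne_top]
  conv_rhs => rw [← hmap]
  rw [← Filter.limsup_comp]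
  congr 1
  funext h
  simp only [Function.comp]
  rw [← ENNReal.ofReal_mul hc.le]
  congr 1
  rw [show a + c * (s + h) = a + c * s + c * h by ring, abs_mul, abs_of_pos hc]
  field_simp

lemma curveIntegral_sub {Y : Type*} [MetricSpace Y] (g : Y → ℝ≥0∞) (γ : Curve Y)
    {a b : ℝ} (ha : 0 ≤ a) (hab : a < b) (hb : b ≤ 1) :
    curveIntegral g (γ.sub ha hab hb) =
      ∫⁻ t in Icc a b, g (γ.toFun t) * speed γ.toFun t := by
  have hc : 0 < b - a := by linarith
  rw [← image_affine_Icc hab, lintegral_image_eq_lintegral_abs_deriv_mul measurableSet_Icc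
    (f' := fun _ => b - a)
    (fun x _ => by simpa using (((hasDerivAt_id x).const_mul (b - a)).const_add a).hasDerivWithinAt)
    (fun x _ y _ h => by simpa [hc.ne'] using h)]
  refine lintegral_congr fun s => ?_
  change g (γ.toFun (a + (b - a) * s)) * speed (fun s => γ.toFun (a + (b - a) * s)) s = _
  rw [speed_comp_affine _ hc, abs_of_pos hc]
  ring

lemma exists_crossing {p : ℝ → ℝ} (hp : ContinuousOn p (Icc 0 1)) {α β : ℝ} (hαβ : α < β)
    (h0 : p 0 ≤ α) (h1 : β ≤ p 1) :
    ∃ a b, 0 ≤ a ∧ a < b ∧ b ≤ 1 ∧ p a = α ∧ p b = β ∧ ∀ s ∈ Ioo a b, p s ∈ Ioo α β := by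
  have hA : IsCompact (Icc (0 : ℝ) 1 ∩ p ⁻¹' Iic α) :=
    isCompact_Icc.of_isClosed_subset (hp.preimage_isClosed_of_isClosed isClosed_Icc isClosed_Iic)
      inter_subset_left
  obtain ⟨a, ⟨ha, hpa⟩, hamax⟩ := hA.exists_isGreatest ⟨0, by simp, h0⟩
  have hpα : p a = α := by
    obtain ⟨s, hs, hsα⟩ := intermediate_value_Icc ha.2 (hp.mono (Icc_subset_Icc_left ha.1))
      ⟨hpa, hαβ.le.trans h1⟩
    have : s = a := le_antisymm (hamax ⟨⟨ha.1.trans hs.1, hs.2⟩, hsα.le⟩) hs.1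
    rwa [← this]
  have hp' : ContinuousOn p (Icc a 1) := hp.mono (Icc_subset_Icc_left ha.1)
  have hB : IsCompact (Icc a 1 ∩ p ⁻¹' Ici β) :=
    isCompact_Icc.of_isClosed_subset (hp'.preimage_isClosed_of_isClosed isClosed_Icc isClosed_Ici)
      inter_subset_left
  obtain ⟨b, ⟨hb, hpb⟩, hbmin⟩ := hB.exists_isLeast ⟨1, ⟨ha.2, le_rfl⟩, h1⟩
  have hpβ : p b = β := by
    obtain ⟨s, hs, hsβ⟩ := intermediate_value_Icc hb.1 (hp'.mono (Icc_subset_Icc_right hb.2))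
      ⟨hpα.le.trans hαβ.le, hpb⟩
    have : s = b := le_antisymm hs.2 (hbmin ⟨⟨hs.1, hs.2.trans hb.2⟩, hsβ.ge⟩)
    rwa [← this]
  have hab : a < b := lt_of_le_of_ne hb.1 fun h => by
    rw [← h, hpα] at hpβ; exact hαβ.ne hpβ
  refine ⟨a, b, ha.1, hab, hb.2, hpα, hpβ, fun s hs => ⟨?_, ?_⟩⟩
  · by_contra! h
    exact hs.1.not_ge (hamax ⟨⟨ha.1.trans hs.1.le, hs.2.le.trans hb.2⟩, h⟩)
  · by_contra! h
    exact hs.2.not_ge (hbmin ⟨⟨hs.1.le, hs.2.le.trans hb.2⟩, h⟩)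

/-- The piecewise linear function that is `0` up to `t`, `1` from `t + h` on, and affine in
between. -/
def ramp (t h y : ℝ) : ℝ := max 0 (min 1 ((y - t) / h))

lemma ramp_nonneg (t h y : ℝ) : 0 ≤ ramp t h y := le_max_left _ _

lemma ramp_le_one (t h y : ℝ) : ramp t h y ≤ 1 := max_le zero_le_one (min_le_left _ _)

lemma ramp_eq_zero {t h y : ℝ} (hh : 0 < h) (hy : y ≤ t) : ramp t h y = 0 :=
  max_eq_left ((min_le_right _ _).trans (div_nonpos_of_nonpos_of_nonneg (by linarith) hh.le))

lemma ramp_eq_one {t h y : ℝ} (hh : 0 < h) (hy : t + h ≤ y) : ramp t h y = 1 := by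
  have : 1 ≤ (y - t) / h := by rw [one_le_div hh]; linarith
  rw [ramp, min_eq_left this, max_eq_right zero_le_one]

lemma le_of_ramp_lt_one {t h y : ℝ} (hh : 0 < h) (hy : ramp t h y < 1) :
    y ≤ t + h * ramp t h y := by
  have h1 : (y - t) / h ≤ ramp t h y := by
    rcases min_choice 1 ((y - t) / h) with h2 | h2
    · rw [ramp, h2] at hy; simp at hy
    · rw [ramp, h2]; exact le_max_right _ _
  rw [div_le_iff₀ hh] at h1
  linarith

lemma le_of_ramp_pos {t h y : ℝ} (hh : 0 < h) (hy : 0 < ramp t h y) :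
    t + h * ramp t h y ≤ y := by
  have h1 : ramp t h y ≤ (y - t) / h := by
    rcases max_choice 0 (min 1 ((y - t) / h)) with h2 | h2
    · rw [ramp, h2] at hy; simp at hy
    · rw [ramp, h2]; exact min_le_right _ _
  rw [le_div_iff₀ hh] at h1
  linarith

lemma abs_ramp_sub_le {t h : ℝ} (hh : 0 < h) (y z : ℝ) :
    |ramp t h y - ramp t h z| ≤ h⁻¹ * |y - z| := by
  unfold ramp
  calc _ ≤ |min 1 ((y - t) / h) - min 1 ((z - t) / h)| := by
        simpa using abs_max_sub_max_le_max 0 (min 1 ((y - t) / h)) 0 (min 1 ((z - t) / h))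
    _ ≤ |(y - t) / h - (z - t) / h| := by
        simpa using abs_min_sub_min_le_max 1 ((y - t) / h) 1 ((z - t) / h)
    _ = h⁻¹ * |y - z| := by
        rw [← sub_div, abs_div, abs_of_pos hh, div_eq_inv_mul]; congr 2; ring

lemma exists_crossing_ramp {p : ℝ → ℝ} (hp : ContinuousOn p (Icc 0 1)) {t h : ℝ} (hh : 0 < h)
    (hne : ramp t h (p 0) ≠ ramp t h (p 1)) :
    ∃ a b, 0 ≤ a ∧ a < b ∧ b ≤ 1 ∧
      |p b - p a| = h * |ramp t h (p 1) - ramp t h (p 0)| ∧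
      ∀ s ∈ Ioo a b, p s ∈ Ioo t (t + h) := by
  have hn0 := ramp_nonneg t h (p 0)
  have hn1 := ramp_nonneg t h (p 1)
  have hl0 := ramp_le_one t h (p 0)
  have hl1 := ramp_le_one t h (p 1)
  rcases lt_or_gt_of_ne hne with hlt | hlt
  · obtain ⟨a, b, ha, hab, hb, hpa, hpb, hs⟩ := exists_crossing hp
      (α := t + h * ramp t h (p 0)) (β := t + h * ramp t h (p 1)) (by nlinarith)
      (le_of_ramp_lt_one hh (by linarith)) (le_of_ramp_pos hh (by linarith))
    refine ⟨a, b, ha, hab, hb, ?_, fun s hsab => ⟨?_, ?_⟩⟩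
    · rw [hpa, hpb, add_sub_add_left_eq_sub, ← mul_sub, abs_mul, abs_of_pos hh]
    · nlinarith [(hs s hsab).1]
    · nlinarith [(hs s hsab).2]
  · obtain ⟨a, b, ha, hab, hb, hpa, hpb, hs⟩ := exists_crossing hp.neg
      (α := -(t + h * ramp t h (p 0))) (β := -(t + h * ramp t h (p 1))) (by nlinarith)
      (neg_le_neg (le_of_ramp_pos hh (by linarith)))
      (neg_le_neg (le_of_ramp_lt_one hh (by linarith)))
    refine ⟨a, b, ha, hab, hb, ?_, fun s hsab => ⟨?_, ?_⟩⟩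
    · rw [neg_injective hpa, neg_injective hpb, add_sub_add_left_eq_sub, ← mul_sub, abs_mul,
        abs_of_pos hh]
    · have := (hs s hsab).2; simp only [Pi.neg_apply] at this; nlinarith
    · have := (hs s hsab).1; simp only [Pi.neg_apply] at this; nlinarith

lemma Curve.continuousOn {Y : Type*} [MetricSpace Y] (γ : Curve Y) : ContinuousOn γ.toFun (Icc 0 1) :=
  γ.lipschitz.choose_spec.continuousOn

lemma Mod1_setOf_sub_mem (μ : Measure X) {Γ : Set (Curve X)} (hΓ : Mod1 μ Γ = 0) :
    Mod1 μ {γ | ∃ (a b : ℝ) (ha : 0 ≤ a) (hab : a < b) (hb : b ≤ 1), γ.sub ha hab hb ∈ Γ} = 0 := by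
  refine le_antisymm (hΓ ▸ le_iInf fun ρ => le_iInf₂ fun hρ hρΓ => ?_) zero_le
  refine iInf_le_of_le ρ (iInf₂_le_of_le hρ ?_ le_rfl)
  rintro γ ⟨a, b, ha, hab, hb, hγ⟩
  refine (hρΓ _ hγ).trans ?_
  rw [curveIntegral_sub]
  exact lintegral_mono_set (Icc_subset_Icc ha hb)

lemma IsWeakUpperGradientOn.ramp_comp {μ : Measure X} {g : X → ℝ≥0∞} {v : X → ℝ} {U : Set X}
    (hg : IsWeakUpperGradientOn μ g v U) (hv : ContinuousOn v U) (t : ℝ) {h : ℝ} (hh : 0 < h) :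
    IsWeakUpperGradientOn μ
      (fun x => (ENNReal.ofReal h)⁻¹ * (U ∩ v ⁻¹' Ioo t (t + h)).indicator g x)
      (fun x => ramp t h (v x)) U := by
  obtain ⟨Γ, hΓ, hgΓ⟩ := hg
  refine ⟨_, Mod1_setOf_sub_mem μ hΓ, fun γ hγ hγU => ?_⟩
  by_cases hne : ramp t h (v (γ.toFun 0)) = ramp t h (v (γ.toFun 1))
  · simp [hne]
  obtain ⟨a, b, ha, hab, hb, habs, hs⟩ := exists_crossing_ramp
    (p := fun s => v (γ.toFun s)) (hv.comp γ.continuousOn hγU) hh hne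
  have hsub : ENNReal.ofReal |v (γ.toFun b) - v (γ.toFun a)| ≤
      ∫⁻ s in Icc a b, g (γ.toFun s) * speed γ.toFun s := by
    have := hgΓ (γ.sub ha hab hb) (fun hmem => hγ ⟨a, b, ha, hab, hb, hmem⟩)
      (fun s hs => hγU _ (Icc_subset_Icc ha hb (affine_mem_Icc hab hs)))
    rw [curveIntegral_sub] at this
    simpa [Curve.sub] using this
  have hIoo : ∫⁻ s in Icc a b, g (γ.toFun s) * speed γ.toFun s ≤
      ∫⁻ s in Icc (0 : ℝ) 1,
        (U ∩ v ⁻¹' Ioo t (t + h)).indicator g (γ.toFun s) * speed γ.toFun s := by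
    rw [setLIntegral_congr Ioo_ae_eq_Icc.symm]
    refine (setLIntegral_congr_fun measurableSet_Ioo fun s hsab => ?_).trans_le
      (lintegral_mono_set (Ioo_subset_Icc_self.trans (Icc_subset_Icc ha hb)))
    rw [indicator_of_mem]
    exact ⟨hγU s ⟨ha.trans hsab.1.le, hsab.2.le.trans hb⟩, hs s hsab⟩
  have hh' : ENNReal.ofReal h ≠ 0 := (ENNReal.ofReal_pos.2 hh).ne'
  simp only [curveIntegral, mul_assoc]
  rw [lintegral_const_mul' _ _ (ENNReal.inv_ne_top.2 hh')]
  rw [mul_comm, ← div_eq_mul_inv,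
    ENNReal.le_div_iff_mul_le (Or.inl hh') (Or.inl ENNReal.ofReal_ne_top), mul_comm,
    ← ENNReal.ofReal_mul hh.le, ← habs]
  exact hsub.trans hIoo

lemma LocLipschitzOn.ramp_comp {Y : Type*} [MetricSpace Y] {v : Y → ℝ} {U : Set Y}
    (hv : LocLipschitzOn v U) (t : ℝ) {h : ℝ} (hh : 0 < h) :
    LocLipschitzOn (fun x => ramp t h (v x)) U := by
  intro K hK hKU
  obtain ⟨L, hL⟩ := hv K hK hKU
  refine ⟨Real.toNNReal h⁻¹ * L, LipschitzOnWith.of_dist_le_mul fun x hx y hy => ?_⟩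
  rw [Real.dist_eq, NNReal.coe_mul, Real.coe_toNNReal _ (inv_nonneg.2 hh.le), mul_assoc]
  exact (abs_ramp_sub_le hh _ _).trans
    (mul_le_mul_of_nonneg_left (hL.dist_le_mul x hx y hy) (inv_nonneg.2 hh.le))

lemma LocLipschitzOn.continuousOn {Y : Type*} [MetricSpace Y] [ProperSpace Y] {v : Y → ℝ}
    {U : Set Y} (hU : IsOpen U) (hv : LocLipschitzOn v U) : ContinuousOn v U := by
  intro x hx
  obtain ⟨K, hK, hxK, hKU⟩ := exists_compact_subset hU hx
  obtain ⟨L, hL⟩ := hv K hK hKU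
  exact (hL.continuousOn.continuousAt (mem_interior_iff_mem_nhds.1 hxK)).continuousWithinAt

lemma exists_compact_exhaustion {Y : Type*} [MetricSpace Y] [ProperSpace Y] {U : Set Y}
    (hU : IsOpen U) :
    ∃ K : ℕ → Set Y, (∀ n, IsCompact (K n)) ∧ (∀ n, K n ⊆ U) ∧
      ∀ L, IsCompact L → L ⊆ U → ∀ᶠ n in atTop, L ⊆ K n := by
  have := hU.locallyCompactSpace
  let E : CompactExhaustion U := default
  refine ⟨fun n => Subtype.val '' E n, fun n => (E.isCompact n).image continuous_subtype_val,
    fun n => Subtype.coe_image_subset _ _, fun L hL hLU => ?_⟩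
  have hL' : IsCompact (Subtype.val ⁻¹' L : Set U) := by
    rw [Subtype.isCompact_iff, Subtype.image_preimage_coe, inter_eq_right.2 hLU]
    exact hL
  obtain ⟨n, hn⟩ := E.exists_superset_of_isCompact hL'
  filter_upwards [eventually_ge_atTop n] with m hm x hx
  exact ⟨⟨x, hLU hx⟩, E.subset hm (hn hx), rfl⟩

lemma exists_approx_of_tv_lt_s3 [BorelSpace X] [ProperSpace X] {μ : Measure X} {u : X → ℝ}
    {U K : Set X} (hU : IsOpen U) (hK : IsCompact K) (hKU : K ⊆ U) {c δ : ℝ≥0∞}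
    (hc : tv μ u U < c) (hδ : 0 < δ) :
    ∃ (v : X → ℝ) (g : X → ℝ≥0∞), Measurable v ∧ Measurable g ∧ LocLipschitzOn v U ∧
      IsWeakUpperGradientOn μ g v U ∧ ∫⁻ x in U, g x ∂μ < c ∧
      ∫⁻ x in K, ENNReal.ofReal |v x - u x| ∂μ < δ := by
  simp only [tv, iInf_lt_iff] at hc
  obtain ⟨v, hvLip, hvu, g, hg, hgv, hlim⟩ := hc
  obtain ⟨i, hi, hi'⟩ := ((frequently_lt_of_liminf_lt (by isBoundedDefault) hlim).and_eventually
    ((hvu K hK hKU).eventually_lt_const hδ)).exists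
  have heq : EqOn (U.indicator (v i)) (v i) U := fun x hx => indicator_of_mem hx _
  refine ⟨U.indicator (v i), g i, ?_, hg i, fun L hL hLU => ?_, ?_, hi, ?_⟩
  · classical
    rw [← piecewise_eq_indicator]
    exact ((hvLip i).continuousOn hU).measurable_piecewise continuousOn_const hU.measurableSet
  · obtain ⟨C, hC⟩ := hvLip i L hL hLU
    exact ⟨C, fun x hx y hy => by rw [heq (hLU hx), heq (hLU hy)]; exact hC hx hy⟩
  · obtain ⟨Γ, hΓ, h⟩ := hgv i
    refine ⟨Γ, hΓ, fun γ hγ hγU => ?_⟩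
    rw [heq (hγU 1 (by simp)), heq (hγU 0 (by simp))]
    exact h γ hγ hγU
  · refine (setLIntegral_congr_fun hK.measurableSet fun x hx => ?_).trans_lt hi'
    simp only [heq (hKU hx)]

lemma ofReal_abs_ramp_sub_chi_le {Y : Type*} (u : Y → ℝ) (x : Y) (v : ℝ) {h : ℝ} (hh : 0 < h)
    (t : ℝ) :
    ENNReal.ofReal |ramp t h v - chi {y | t < u y} x| ≤
      (Icc (min v (u x) - h) (max v (u x))).indicator 1 t := by
  by_cases ht : t ∈ Icc (min v (u x) - h) (max v (u x))
  · rw [indicator_of_mem ht, Pi.one_apply, ← ENNReal.ofReal_one]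
    refine ENNReal.ofReal_le_ofReal (abs_sub_le_iff.2 ⟨?_, ?_⟩) <;>
    · have := ramp_nonneg t h v
      have := ramp_le_one t h v
      have h1 : 0 ≤ chi {y | t < u y} x := indicator_nonneg (fun _ _ => zero_le_one) _
      have h2 : chi {y | t < u y} x ≤ 1 := indicator_le_self' (fun _ _ => zero_le_one) _
      linarith
  · rw [indicator_of_notMem ht]
    rw [mem_Icc, not_and_or, not_le, not_le] at ht
    rcases ht with ht | ht
    · have h1 := min_le_left v (u x)
      have h2 := min_le_right v (u x)
      rw [ramp_eq_one hh (by linarith), chi,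
        indicator_of_mem (by simp only [mem_ofPred_eq]; linarith)]
      simp
    · have h1 := le_max_left v (u x)
      have h2 := le_max_right v (u x)
      rw [ramp_eq_zero hh (by linarith), chi,
        indicator_of_notMem (by simp only [mem_ofPred_eq]; linarith)]
      simp

lemma lintegral_abs_ramp_sub_chi_le {Y : Type*} (u : Y → ℝ) (x : Y) (v : ℝ) {h : ℝ} (hh : 0 < h) :
    ∫⁻ t, ENNReal.ofReal |ramp t h v - chi {y | t < u y} x| ≤
      ENNReal.ofReal |v - u x| + ENNReal.ofReal h := by
  refine (lintegral_mono (ofReal_abs_ramp_sub_chi_le u x v hh)).trans_eq ?_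
  rw [lintegral_indicator_one measurableSet_Icc, Real.volume_Icc,
    ← ENNReal.ofReal_add (abs_nonneg _) hh.le]
  congr 1
  rw [← max_sub_min_eq_abs']
  ring

lemma measurable_abs_ramp_sub_chi {Y : Type*} [MeasurableSpace Y] {u v : Y → ℝ}
    (hu : Measurable u) (hv : Measurable v) (h : ℝ) :
    Measurable fun p : ℝ × Y => ENNReal.ofReal |ramp p.1 h (v p.2) - chi {y | p.1 < u y} p.2| := by
  have h1 : Measurable fun p : ℝ × Y => ramp p.1 h (v p.2) := by
    unfold ramp; fun_prop
  have h2 : Measurable fun p : ℝ × Y => chi {y | p.1 < u y} p.2 :=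
    ((measurable_const (a := (1 : ℝ))).indicator (s := {p : ℝ × Y | p.1 < u p.2})
      (measurableSet_lt measurable_fst (hu.comp measurable_snd)) :)
  fun_prop

lemma measurable_indicator_Ioo {Y : Type*} [MeasurableSpace Y] {v : Y → ℝ} {g : Y → ℝ≥0∞}
    (hv : Measurable v) (hg : Measurable g) {U : Set Y} (hU : MeasurableSet U) (h : ℝ) :
    Measurable fun p : ℝ × Y => (U ∩ v ⁻¹' Ioo p.1 (p.1 + h)).indicator g p.2 :=
  ((hg.comp measurable_snd).indicator
    (s := {p : ℝ × Y | p.2 ∈ U} ∩ ({p | p.1 < v p.2} ∩ {p | v p.2 < p.1 + h}))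
    ((measurable_snd hU).inter ((measurableSet_lt measurable_fst (hv.comp measurable_snd)).inter
      (measurableSet_lt (hv.comp measurable_snd) (measurable_fst.add_const h)))) :)

lemma lintegral_indicator_Ioo_le {Y : Type*} (v : Y → ℝ) (g : Y → ℝ≥0∞) (U : Set Y) {h : ℝ}
    (hh : 0 < h) (x : Y) :
    ∫⁻ t, (ENNReal.ofReal h)⁻¹ * (U ∩ v ⁻¹' Ioo t (t + h)).indicator g x ≤ g x := by
  have hh' : ENNReal.ofReal h ≠ 0 := (ENNReal.ofReal_pos.2 hh).ne'
  have hle : ∀ t, (U ∩ v ⁻¹' Ioo t (t + h)).indicator g x ≤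
      (Ioo (v x - h) (v x)).indicator (fun _ => g x) t := by
    intro t
    refine indicator_apply_le' (fun hx => ?_) fun _ => zero_le
    rw [indicator_of_mem]
    exact ⟨by linarith [hx.2.2], hx.2.1⟩
  rw [lintegral_const_mul' _ _ (ENNReal.inv_ne_top.2 hh')]
  calc _ ≤ (ENNReal.ofReal h)⁻¹ * ∫⁻ t, (Ioo (v x - h) (v x)).indicator (fun _ => g x) t := by
        gcongr; exact hle _
    _ = g x := by
        rw [lintegral_indicator_const measurableSet_Ioo, Real.volume_Ioo, sub_sub_cancel,
          mul_left_comm, ENNReal.inv_mul_cancel hh' ENNReal.ofReal_ne_top, mul_one]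

/-- The coarea inequality, with a measurable majorant for the perimeters of the superlevel sets. -/
theorem exists_tv_superlevel_le [BorelSpace X] [ProperSpace X] (μ : Measure X)
    [IsLocallyFiniteMeasure μ] {u : X → ℝ} (hu : Measurable u) {U : Set X} (hU : IsOpen U)
    (hfin : tv μ u U < ∞) :
    ∃ F : ℝ → ℝ≥0∞, Measurable F ∧ (∀ᵐ t : ℝ, tv μ (chi {x | t < u x}) U ≤ F t) ∧
      ∫⁻ t, F t ≤ tv μ u U := by
  obtain ⟨K, hK, hKU, hKex⟩ := exists_compact_exhaustion hU
  obtain ⟨δ, hδ, hδsum⟩ := ENNReal.exists_pos_sum_of_countable one_ne_zero ℕ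
  have hδ' : ∀ n, 0 < (δ n : ℝ≥0∞) := fun n => ENNReal.coe_pos.2 (hδ n)
  have hδfin : ∑' n, (δ n : ℝ≥0∞) ≠ ∞ := (hδsum.trans ENNReal.one_lt_top).ne
  have hδlim := ENNReal.tendsto_atTop_zero_of_tsum_ne_top hδfin
  choose v g hv hg hvLip hgv hgle hvu using fun n =>
    exists_approx_of_tv_lt_s3 hU (hK n) (hKU n) (ENNReal.lt_add_right hfin.ne (hδ' n).ne') (hδ' n)
  have hhex : ∀ n, ∃ h : ℝ, 0 < h ∧ ENNReal.ofReal h * μ (K n) ≤ δ n := by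
    intro n
    refine ⟨δ n / ((μ (K n)).toReal + 1), by have := hδ n; positivity, ?_⟩
    rw [← ENNReal.ofReal_toReal (hK n).measure_lt_top.ne, ← ENNReal.ofReal_mul (by positivity),
      ← ENNReal.ofReal_coe_nnreal]
    refine ENNReal.ofReal_le_ofReal ?_
    rw [ENNReal.toReal_ofReal ENNReal.toReal_nonneg, div_mul_eq_mul_div,
      div_le_iff₀ (by positivity)]
    nlinarith [(δ n).2]
  choose h hh hhle using hhex
  let G : ℕ → ℝ → ℝ≥0∞ := fun n t => ∫⁻ x in U,
    (ENNReal.ofReal (h n))⁻¹ * (U ∩ v n ⁻¹' Ioo t (t + h n)).indicator (g n) x ∂μ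
  have hGmeas' : ∀ n, Measurable fun p : ℝ × X => (ENNReal.ofReal (h n))⁻¹ *
      (U ∩ v n ⁻¹' Ioo p.1 (p.1 + h n)).indicator (g n) p.2 := fun n =>
    (measurable_indicator_Ioo (hv n) (hg n) hU.measurableSet (h n)).const_mul _
  have hGmeas : ∀ n, Measurable (G n) := fun n => (hGmeas' n).lintegral_prod_right'
  have hGle : ∀ n, ∫⁻ t, G n t ≤ tv μ u U + δ n := by
    intro n
    rw [lintegral_lintegral_swap (hGmeas' n).aemeasurable]
    exact (lintegral_mono fun x => lintegral_indicator_Ioo_le _ _ _ (hh n) x).trans (hgle n).le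
  let Φ : ℕ → ℝ → ℝ≥0∞ := fun n t =>
    ∫⁻ x in K n, ENNReal.ofReal |ramp t (h n) (v n x) - chi {y | t < u y} x| ∂μ
  have hΦmeas : ∀ n, Measurable (Φ n) := fun n =>
    (measurable_abs_ramp_sub_chi hu (hv n) (h n)).lintegral_prod_right'
  have hΦle : ∀ n, ∫⁻ t, Φ n t ≤ 2 * δ n := by
    intro n
    rw [lintegral_lintegral_swap (measurable_abs_ramp_sub_chi hu (hv n) (h n)).aemeasurable]
    calc _ ≤ ∫⁻ x in K n, (ENNReal.ofReal |v n x - u x| + ENNReal.ofReal (h n)) ∂μ :=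
          lintegral_mono fun x => lintegral_abs_ramp_sub_chi_le u x _ (hh n)
      _ = ∫⁻ x in K n, ENNReal.ofReal |v n x - u x| ∂μ + ENNReal.ofReal (h n) * μ (K n) := by
          rw [lintegral_add_right _ measurable_const, setLIntegral_const]
      _ ≤ δ n + δ n := add_le_add (hvu n).le (hhle n)
      _ = 2 * δ n := (two_mul _).symm
  have hΦae : ∀ᵐ t : ℝ, Tendsto (fun n => Φ n t) atTop (𝓝 0) := by
    have hsum : ∫⁻ t, ∑' n, Φ n t ≠ ∞ := by
      rw [lintegral_tsum fun n => (hΦmeas n).aemeasurable]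
      refine ne_top_of_le_ne_top ?_ (ENNReal.tsum_le_tsum hΦle)
      rw [ENNReal.tsum_mul_left]
      exact ENNReal.mul_ne_top ENNReal.ofNat_ne_top hδfin
    filter_upwards [ae_lt_top (Measurable.tsum hΦmeas) hsum] with t ht
    exact ENNReal.tendsto_atTop_zero_of_tsum_ne_top ht.ne
  refine ⟨fun t => liminf (fun n => G n t) atTop, .liminf hGmeas, ?_, ?_⟩
  · filter_upwards [hΦae] with t ht
    refine iInf₂_le_of_le (fun n x => ramp t (h n) (v n x))
      (fun n => (hvLip n).ramp_comp t (hh n)) (iInf₂_le_of_le ?_ _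
        (iInf₂_le_of_le ?_ (fun n => (hgv n).ramp_comp ((hvLip n).continuousOn hU) t (hh n))
          le_rfl))
    · intro L hL hLU
      refine tendsto_of_tendsto_of_tendsto_of_le_of_le' tendsto_const_nhds ht
        (Eventually.of_forall fun _ => zero_le) ?_
      filter_upwards [hKex L hL hLU] with n hn
      exact lintegral_mono_set hn
    · exact fun n => (hGmeas' n).comp measurable_prodMk_left
  · calc ∫⁻ t, liminf (fun n => G n t) atTop ≤ liminf (fun n => ∫⁻ t, G n t) atTop :=
          lintegral_liminf_le hGmeas
      _ ≤ liminf (fun n => tv μ u U + δ n) atTop := liminf_le_liminf (.of_forall hGle)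
      _ = tv μ u U := by
          have := (tendsto_const_nhds (x := tv μ u U)).add hδlim
          rw [add_zero] at this
          exact this.liminf_eq

lemma tv_congr_ae {μ : Measure X} {u w : X → ℝ} (huw : u =ᵐ[μ] w) (U : Set X) :
    tv μ u U = tv μ w U := by
  have : ∀ v, TendstoL1Loc μ v u U ↔ TendstoL1Loc μ v w U := fun v => by
    refine forall₃_congr fun K _ _ => iff_of_eq ?_
    congr 1
    funext i
    refine lintegral_congr_ae (ae_restrict_of_ae ?_)
    filter_upwards [huw] with x hx
    rw [hx]
  simp only [tv, this]

lemma integrable_chi {Y : Type*} [MeasurableSpace Y] {μ : Measure Y} {E : Set Y}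
    (hE : MeasurableSet E) (hμE : μ E < ∞) :
    Integrable (chi E) μ :=
  (integrable_indicator_iff hE).2 (integrableOn_const hμE.ne)

lemma ae_tv_superlevel_lt_top [BorelSpace X] [ProperSpace X] {μ : Measure X}
    [IsLocallyFiniteMeasure μ] {u : X → ℝ} (hu : Measurable u) {U : Set X} (hU : IsOpen U)
    (hfin : tv μ u U < ∞) : ∀ᵐ t : ℝ, tv μ (chi {x | t < u x}) U < ∞ := by
  obtain ⟨F, hF, hFtv, hFint⟩ := exists_tv_superlevel_le μ hu hU hfin
  filter_upwards [hFtv, ae_lt_top hF (hFint.trans_lt hfin).ne] with t h1 h2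
  exact h1.trans_lt h2

/-- Almost every superlevel set of a function of locally bounded variation has locally finite
perimeter. -/
lemma ae_forall_compact_tv_superlevel_lt_top [BorelSpace X] [ProperSpace X] {μ : Measure X}
    [IsLocallyFiniteMeasure μ] {u : X → ℝ} (hu : Measurable u) (hloc : MemBVloc μ u univ) :
    ∀ᵐ t : ℝ, ∀ K, IsCompact K → ∃ U, IsOpen U ∧ K ⊆ U ∧
      tv μ (chi {x | t < u x}) U < ∞ := by
  obtain ⟨K, hK, -, hKex⟩ := exists_compact_exhaustion (isOpen_univ (X := X))
  choose U hU hKU _ hBV using fun n => hloc (K n) (hK n) (subset_univ _)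
  filter_upwards [ae_all_iff.2 fun n => ae_tv_superlevel_lt_top hu (hU n) (hBV n).2] with t ht L hL
  obtain ⟨n, hn⟩ := (hKex L hL (subset_univ _)).exists
  exact ⟨U n, hU n, hn.trans (hKU n), ht n⟩

lemma MemBVloc.congr_ae {μ : Measure X} {u w : X → ℝ} {Ω : Set X} (hu : MemBVloc μ u Ω)
    (huw : u =ᵐ[μ] w) : MemBVloc μ w Ω := fun K hK hKΩ => by
  obtain ⟨U, hU, hKU, hUΩ, huint, htv⟩ := hu K hK hKΩ
  exact ⟨U, hU, hKU, hUΩ, huint.congr (ae_restrict_of_ae huw), by rwa [← tv_congr_ae huw]⟩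

lemma exists_superlevel_tv_le [BorelSpace X] [ProperSpace X] {μ : Measure X}
    [IsLocallyFiniteMeasure μ] {u : X → ℝ} (hu : Measurable u) (hloc : MemBVloc μ u univ) :
    ∃ t ∈ Ioo (0 : ℝ) 1, tv μ (chi {x | t < u x}) univ ≤ tv μ u univ ∧
      ∀ K, IsCompact K → ∃ U, IsOpen U ∧ K ⊆ U ∧ tv μ (chi {x | t < u x}) U < ∞ := by
  have hprob : IsProbabilityMeasure ((volume : Measure ℝ).restrict (Ioo 0 1)) :=
    ⟨by simp⟩
  have hae : ∀ᵐ t ∂(volume : Measure ℝ).restrict (Ioo 0 1), t ∈ Ioo (0 : ℝ) 1 ∧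
      ∀ K, IsCompact K → ∃ U, IsOpen U ∧ K ⊆ U ∧ tv μ (chi {x | t < u x}) U < ∞ :=
    (ae_restrict_mem measurableSet_Ioo).and
      (ae_restrict_of_ae (ae_forall_compact_tv_superlevel_lt_top hu hloc))
  by_cases hfin : tv μ u univ < ∞
  · obtain ⟨F, hF, hFtv, hFint⟩ := exists_tv_superlevel_le μ hu isOpen_univ hfin
    obtain ⟨t, ht, htF⟩ := exists_notMem_null_le_lintegral hF.aemeasurable
      (ae_iff.1 (hae.and (ae_restrict_of_ae hFtv)))
    obtain ⟨⟨ht01, hK⟩, htv⟩ := not_not.1 ht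
    exact ⟨t, ht01, htv.trans (htF.trans ((setLIntegral_le_lintegral _ _).trans hFint)), hK⟩
  · obtain ⟨t, ht01, hK⟩ := hae.exists
    exact ⟨t, ht01, by rw [not_lt_top_iff.1 hfin]; exact le_top, hK⟩

/-- If there exists a solution of the `K_{χ_A,0}(Ω)`-obstacle problem, then there exists a set
`E ⊆ X` such that `χ_E` is also a solution. -/
theorem obstacle_problem_set_solution
    {X : Type*} [MetricSpace X] [MeasurableSpace X] [BorelSpace X]
    (μ : Measure X) (Cd CP lam : ℝ) (hX : MMS μ Cd CP lam)
    (Ω : Set X) (hΩopen : IsOpen Ω) (hΩne : Ω.Nonempty) (hΩbdd : Bornology.IsBounded Ω)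
    (A : Set X)
    (hex : ∃ u : X → ℝ,
      IsObstacleSolution μ (fun y => ((chi A y : ℝ) : EReal)) (fun _ => (0 : ℝ)) Ω u) :
    ∃ E : Set X,
      IsObstacleSolution μ (fun y => ((chi A y : ℝ) : EReal)) (fun _ => (0 : ℝ)) Ω (chi E) := by
  have := hX.properSpace_s3
  have := hX.isLocallyFiniteMeasure_s3
  obtain ⟨u, ⟨hloc, hψ, h0⟩, hmin⟩ := hex
  have hum : AEMeasurable u μ := by
    obtain ⟨U, -, hΩU, -, huint, -⟩ := hloc (closure Ω) hΩbdd.isCompact_closure (subset_univ _)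
    have hΩ : AEMeasurable u (μ.restrict Ω) :=
      (huint.mono_set (subset_closure.trans hΩU)).aestronglyMeasurable.aemeasurable
    refine ((aemeasurable_indicator_iff hΩopen.measurableSet).2 hΩ).congr ?_
    filter_upwards [h0] with x hx
    by_cases hxΩ : x ∈ Ω
    · exact indicator_of_mem hxΩ u
    · rw [indicator_of_notMem hxΩ, hx hxΩ]
  set w := hum.mk u
  have huw : u =ᵐ[μ] w := hum.ae_eq_mk
  have hw : Measurable w := hum.measurable_mk
  obtain ⟨t, ht01, htv, hK⟩ := exists_superlevel_tv_le hw (hloc.congr_ae huw)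
  set E : Set X := {x | t < w x}
  have hEΩ : ∀ᵐ x ∂μ, x ∉ Ω → x ∉ E := by
    filter_upwards [h0, huw] with x hx hxw hxΩ (hxE : t < w x)
    rw [← hxw, hx hxΩ] at hxE
    exact hxE.not_gt ht01.1
  have hEint : Integrable (chi E) μ := by
    refine integrable_chi (measurableSet_lt measurable_const hw) ?_
    refine (measure_mono_ae ?_).trans_lt hΩbdd.measure_lt_top
    filter_upwards [hEΩ] with x hx hxE
    exact not_imp_not.1 hx hxE
  refine ⟨E, ⟨fun K hKc _ => ?_, ?_, ?_⟩, fun v hv => ?_⟩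
  · obtain ⟨U, hU, hKU, hUtv⟩ := hK K hKc
    exact ⟨U, hU, hKU, subset_univ _, hEint.integrableOn, hUtv⟩
  · filter_upwards [hψ, huw] with x hx hxw hxΩ
    rw [EReal.coe_le_coe_iff]
    have hAx := EReal.coe_le_coe_iff.1 (hx hxΩ)
    by_cases hxA : x ∈ A
    · rw [chi, indicator_of_mem hxA] at hAx
      have hxE : x ∈ E := (ht01.2.trans_le hAx).trans_eq hxw
      rw [chi, chi, indicator_of_mem hxA, indicator_of_mem hxE]
    · rw [chi, indicator_of_notMem hxA]
      exact indicator_nonneg (fun _ _ => zero_le_one) x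
  · filter_upwards [hEΩ] with x hx hxΩ
    exact indicator_of_notMem (hx hxΩ) _
  · exact (htv.trans_eq (tv_congr_ae huw _).symm).trans (hmin v hv)

end MetricBV
end
end
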